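/- Let Ω be a canonical ideal of A with I ⊆ Ω, set h = n − d (the height of I), and suppose u ∈ R satisfies (I^{[p]} : I) ∩ (Ω^{[p]} : Ω) = I^{[p]} + (u). Then for every e ≥ 0, multiplication by u^{p^e} maps Ω^{[p^e]} into Ω^{[p^{e+1}]} and I^{[p^e]} into I^{[p^{e+1}]}, hence induces R-linear maps Ω^{[p^e]}/I^{[p^e]} → Ω^{[p^{e+1}]}/I^{[p^{e+1}]}, and the local cohomology module H^h_I(R) is isomorphic to the colimit of the resulting direct system Ω/I → Ω^{[p]}/I^{[p]} → Ω^{[p^2]}/I^{[p^2]} → ⋯. -/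

import Mathlib

/-- `𝔞^{[q]}`: the ideal generated by the `q`-th powers of all elements of `𝔞`. -/
def frobPow {R : Type} [CommRing R] (q : ℕ) (a : Ideal R) : Ideal R :=
  Ideal.span ((fun x => x ^ q) '' (a : Set R))

noncomputable def extModule (R : Type) [CommRing R] (e : ℕ) (M N : Type) [AddCommGroup M]
    [AddCommGroup N] [Module R M] [Module R N] : ModuleCat R :=
  ((Ext R (ModuleCat R) e).obj (Opposite.op (ModuleCat.of R M))).obj (ModuleCat.of R N)

/-- `Ω` is a canonical ideal of `A = R/I`: `I ⊆ Ω ⊆ R` and `Ω/I ≅ Ext_R^e(R/I, R)`,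
where `e = n - d`. -/
def IsCanonicalIdeal (R : Type) [CommRing R] (e : ℕ) (I Ω : Ideal R) : Prop :=
  I ≤ Ω ∧ Nonempty
    ((↥Ω ⧸ (Submodule.comap Ω.subtype (I : Submodule R R))) ≃ₗ[R] extModule R e (R ⧸ I) R)

def IsCohenMacaulayLocalOfDim (A : Type) [CommRing A] (m : Ideal A) (d : ℕ) : Prop :=
  ringKrullDim A = d ∧
    ∃ rs : List A, rs.length = d ∧ (∀ x ∈ rs, x ∈ m) ∧ RingTheory.Sequence.IsRegular A rs

/-- The `R`-module `Ω^{[p^e]}/I^{[p^e]}`. -/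
abbrev quotFrob (R : Type) [CommRing R] (p : ℕ) (Ω I : Ideal R) (e : ℕ) : Type :=
  ↥(frobPow (p ^ e) Ω) ⧸
    Submodule.comap (frobPow (p ^ e) Ω).subtype (frobPow (p ^ e) I : Submodule R R)

section

open Matrix

/-- An augmented sequence of matrices `⋯ → R^{r 1} → R^{r 0} → R`. -/
structure MatComplex (R : Type) [CommRing R] where
  rk : ℕ → ℕ
  d : ∀ i, Matrix (Fin (rk i)) (Fin (rk (i + 1))) R
  aug : Fin (rk 0) → R

namespace MatComplex

variable {R : Type} [CommRing R]

/-- The coboundaries of the transposed complex. -/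
def cobd (P : MatComplex R) : ∀ i, Submodule R (Fin (P.rk i) → R)
  | 0 => ⊥
  | i + 1 => LinearMap.range (P.d i).vecMulLinear

/-- `P` is a free resolution of `R ⧸ I` of length `h` whose transpose is exact below `h`. -/
structure IsRes (P : MatComplex R) (I : Ideal R) (h : ℕ) : Prop where
  aug_mem : ∀ x, P.aug ⬝ᵥ x ∈ I ↔ ∃ y, P.d 0 *ᵥ y = x
  aug_surj : ∃ x, P.aug ⬝ᵥ x - 1 ∈ I
  exact : ∀ i x, P.d i *ᵥ x = 0 ↔ ∃ y, P.d (i + 1) *ᵥ y = x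
  rk_top : ∀ i, h < i → P.rk i = 0
  dual_exact : ∀ i < h, ∀ z, z ᵥ* P.d i = 0 → z ∈ P.cobd i

/-- A family of matrices commuting with the differentials. -/
def IsChainMap (Q P : MatComplex R) (g : ∀ i, Matrix (Fin (P.rk i)) (Fin (Q.rk i)) R) : Prop :=
  ∀ i, g i * Q.d i = P.d i * g (i + 1)

theorem _root_.Matrix.exists_mul_eq {l m n : Type} [Fintype m] [Fintype n] [DecidableEq n]
    (A : Matrix l m R) (B : Matrix l n R)
    (H : ∀ x, ∃ y, A *ᵥ y = B *ᵥ x) : ∃ S : Matrix m n R, A * S = B := by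
  choose y hy using fun j => H (Pi.single j 1)
  refine ⟨fun i j => y j i, ?_⟩
  ext i j
  have := congrFun (hy j) i
  rw [Matrix.mulVec_single_one] at this
  exact this

theorem _root_.Matrix.exists_mul_eq' {l m n : Type} [Fintype m] [Fintype n] [Fintype l]
    [DecidableEq l]
    (A : Matrix m n R) (B : Matrix l n R)
    (H : ∀ x, ∃ y, y ᵥ* A = x ᵥ* B) : ∃ S : Matrix l m R, S * A = B := by
  obtain ⟨S, hS⟩ := Matrix.exists_mul_eq Aᵀ Bᵀ (by simpa [Matrix.mulVec_transpose] using H)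
  exact ⟨Sᵀ, by simpa using congrArg Matrix.transpose hS⟩

theorem _root_.Matrix.eq_of_vecMul {m n : Type} [Fintype m] [DecidableEq m]
    {A B : Matrix m n R} (H : ∀ x, x ᵥ* A = x ᵥ* B) : A = B := by
  ext i j
  simpa using congrFun (H (Pi.single i 1)) j

theorem _root_.Matrix.eq_of_mulVec {m n : Type} [Fintype n] [DecidableEq n]
    {A B : Matrix m n R} (H : ∀ x, A *ᵥ x = B *ᵥ x) : A = B := by
  ext i j
  simpa using congrFun (H (Pi.single j 1)) i

variable {P Q : MatComplex R} {I J : Ideal R} {h : ℕ}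

theorem IsRes.d_mul_d (hP : P.IsRes I h) (i : ℕ) : P.d i * P.d (i + 1) = 0 :=
  Matrix.eq_of_mulVec fun x => by
    rw [← Matrix.mulVec_mulVec, (hP.exact i _).2 ⟨x, rfl⟩, Matrix.zero_mulVec]

theorem IsRes.vecMul_of_mem_cobd (hP : P.IsRes I h) {i : ℕ} {z : Fin (P.rk i) → R}
    (hz : z ∈ P.cobd i) : z ᵥ* P.d i = 0 := by
  cases i with
  | zero =>
    rw [(Submodule.mem_bot R).1 hz, Matrix.zero_vecMul]
  | succ i =>
    obtain ⟨w, rfl⟩ := hz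
    simp [Matrix.vecMul_vecMul, hP.d_mul_d]

theorem IsRes.d_top (hP : P.IsRes I h) {l : Type} {i : ℕ} (hi : h ≤ i)
    (s : Matrix (Fin (P.rk (i + 1))) l R) :
    P.d i * s = 0 := by
  have := hP.rk_top (i + 1) (by omega)
  have : IsEmpty (Fin (P.rk (i + 1))) := by rw [this]; infer_instance
  ext a b
  simp [Matrix.mul_apply]

theorem IsRes.isEmpty (hP : P.IsRes I h) {i : ℕ} (hi : h < i) : IsEmpty (Fin (P.rk i)) := by
  rw [hP.rk_top i hi]; infer_instance

/-- A map in degree `h` preserving coboundaries extends to a chain map. -/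
theorem exists_chainMap_of_top (hP : P.IsRes I h) (hQ : Q.IsRes J h)
    (gh : Matrix (Fin (P.rk h)) (Fin (Q.rk h)) R)
    (hg : ∀ z ∈ P.cobd h, z ᵥ* gh ∈ Q.cobd h) :
    ∃ g, IsChainMap Q P g ∧ g h = gh := by
  have key : ∀ m ≤ h, ∀ gm : Matrix (Fin (P.rk m)) (Fin (Q.rk m)) R,
      (∀ z ∈ P.cobd m, z ᵥ* gm ∈ Q.cobd m) →
      ∃ g : ∀ i, Matrix (Fin (P.rk i)) (Fin (Q.rk i)) R,
        (∀ i < m, g i * Q.d i = P.d i * g (i + 1)) ∧ g m = gm := by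
    intro m
    induction m with
    | zero =>
      intro _ gm _
      exact ⟨Function.update (fun _ => 0) 0 gm, by simp, by simp⟩
    | succ m ih =>
      intro hm gm hgm
      obtain ⟨S, hS⟩ := Matrix.exists_mul_eq' (Q.d m) (P.d m * gm) (fun x => by
        obtain ⟨w, hw⟩ := hgm (x ᵥ* P.d m) ⟨x, rfl⟩
        exact ⟨w, by rw [← Matrix.vecMul_vecMul]; exact hw⟩)
      obtain ⟨g, hg1, hg2⟩ := ih (by omega) S (fun z hz => by
        apply hQ.dual_exact m (by omega)
        rw [Matrix.vecMul_vecMul, hS, ← Matrix.vecMul_vecMul, hP.vecMul_of_mem_cobd hz,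
          Matrix.zero_vecMul])
      refine ⟨Function.update g (m + 1) gm, ?_, by simp⟩
      intro i hi
      rw [Function.update_of_ne (by omega)]
      rcases Nat.lt_succ_iff_lt_or_eq.1 hi with hi | rfl
      · rw [Function.update_of_ne (by omega)]
        exact hg1 i hi
      · simp [hg2, hS]
  obtain ⟨g, hg1, hg2⟩ := key h le_rfl gh hg
  refine ⟨g, fun i => ?_, hg2⟩
  by_cases hi : i < h
  · exact hg1 i hi
  · have := hQ.isEmpty (i := i + 1) (by omega)
    ext a b
    exact isEmptyElim b

theorem IsChainMap.mem_cobd {g} (hg : IsChainMap Q P g) (i : ℕ) {z} (hz : z ∈ P.cobd i) :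
    z ᵥ* g i ∈ Q.cobd i := by
  cases i with
  | zero => rw [(Submodule.mem_bot R).1 hz, Matrix.zero_vecMul]; exact zero_mem _
  | succ i =>
    obtain ⟨w, rfl⟩ := hz
    refine ⟨w ᵥ* g i, ?_⟩
    simp [Matrix.vecMul_vecMul, hg i]

/-- A chain map inducing zero on the resolved modules induces zero on top cohomology. -/
theorem IsChainMap.top_mem_cobd (hP : P.IsRes I h) (hQ : Q.IsRes J h) {g}
    (hg : IsChainMap Q P g) (h0 : ∀ x, P.aug ⬝ᵥ (g 0 *ᵥ x) ∈ I) (z) :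
    z ᵥ* g h ∈ Q.cobd h := by
  have key : ∀ i, ∃ T, (∀ z, z ᵥ* T ∈ Q.cobd i) ∧
      ∃ s : Matrix (Fin (P.rk (i + 1))) (Fin (Q.rk i)) R, g i - T = P.d i * s := by
    intro i
    induction i with
    | zero =>
      refine ⟨0, fun z => by simp, ?_⟩
      obtain ⟨S, hS⟩ := Matrix.exists_mul_eq (P.d 0) (g 0) fun x => (hP.aug_mem _).1 (h0 x)
      exact ⟨S, by rw [hS, sub_zero]⟩
    | succ i ih =>
      obtain ⟨T, hT, s, hs⟩ := ih
      refine ⟨s * Q.d i, fun z => ⟨z ᵥ* s, by simp [Matrix.vecMul_vecMul]⟩, ?_⟩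
      have hTd : T * Q.d i = 0 := Matrix.eq_of_vecMul fun x => by
        rw [← Matrix.vecMul_vecMul, hQ.vecMul_of_mem_cobd (hT x), Matrix.vecMul_zero]
      have h1 : P.d i * (g (i + 1) - s * Q.d i) = 0 := by
        rw [Matrix.mul_sub, ← hg i, ← Matrix.mul_assoc, ← hs, Matrix.sub_mul, hTd]
        simp
      obtain ⟨S, hS⟩ := Matrix.exists_mul_eq (P.d (i + 1)) (g (i + 1) - s * Q.d i) fun x =>
        (hP.exact i _).1 (by rw [Matrix.mulVec_mulVec, h1, Matrix.zero_mulVec])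
      exact ⟨S, hS.symm⟩
  obtain ⟨T, hT, s, hs⟩ := key h
  rw [hP.d_top le_rfl, sub_eq_zero] at hs
  rw [hs]
  exact hT z

/-- A chain map inducing zero on top cohomology induces zero on the resolved modules. -/
theorem IsChainMap.aug_mem_of_top (hP : P.IsRes I h) (hQ : Q.IsRes J h) {g}
    (hg : IsChainMap Q P g) (htop : ∀ z, z ᵥ* g h ∈ Q.cobd h) (x) :
    P.aug ⬝ᵥ (g 0 *ᵥ x) ∈ I := by
  have key : ∀ m ≤ h, ∀ S : Matrix (Fin (P.rk (m + 1))) (Fin (Q.rk m)) R,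
      (∀ z, z ᵥ* (g m - P.d m * S) ∈ Q.cobd m) →
      P.aug ⬝ᵥ (g 0 *ᵥ x) ∈ I := by
    intro m
    induction m with
    | zero =>
      intro _ S hS
      have : g 0 = P.d 0 * S := sub_eq_zero.1 <| Matrix.eq_of_vecMul fun x => by
        rw [(Submodule.mem_bot R).1 (hS x), Matrix.vecMul_zero]
      rw [this]
      exact (hP.aug_mem _).2 ⟨S *ᵥ x, by simp⟩
    | succ m ih =>
      intro hm S hS
      obtain ⟨U, hU⟩ := Matrix.exists_mul_eq' (Q.d m) (g (m + 1) - P.d (m + 1) * S)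
        fun x => hS x
      refine ih (by omega) U fun z => ?_
      apply hQ.dual_exact m (by omega)
      rw [Matrix.vecMul_vecMul, Matrix.sub_mul, hg m, Matrix.mul_assoc, hU, Matrix.mul_sub,
        ← Matrix.mul_assoc, hP.d_mul_d]
      simp
  exact key h le_rfl 0 fun z => by simpa using htop z

/-- The comparison theorem. -/
theorem exists_chainMap (hP : P.IsRes I h) (hQ : Q.IsRes J h) (hJI : J ≤ I) :
    ∃ g, IsChainMap Q P g ∧ ∀ x, P.aug ⬝ᵥ (g 0 *ᵥ x) - Q.aug ⬝ᵥ x ∈ I := by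
  have key : ∀ m, ∃ g : ∀ i, Matrix (Fin (P.rk i)) (Fin (Q.rk i)) R,
      (∀ i < m, g i * Q.d i = P.d i * g (i + 1)) ∧
        ∀ x, P.aug ⬝ᵥ (g 0 *ᵥ x) - Q.aug ⬝ᵥ x ∈ I := by
    intro m
    induction m with
    | zero =>
      obtain ⟨e, he⟩ := hP.aug_surj
      refine ⟨Function.update (fun _ => 0) 0 (Matrix.vecMulVec e Q.aug), by simp, fun x => ?_⟩
      rw [Function.update_self, Matrix.vecMulVec_mulVec]
      have : P.aug ⬝ᵥ (MulOpposite.op (Q.aug ⬝ᵥ x) • e) - Q.aug ⬝ᵥ x =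
        (P.aug ⬝ᵥ e - 1) * (Q.aug ⬝ᵥ x) := by
        rw [dotProduct_smul]
        simp [sub_mul]
      rw [this]
      exact I.mul_mem_right _ he
    | succ m ih =>
      obtain ⟨g, hg1, hg2⟩ := ih
      obtain ⟨S, hS⟩ := Matrix.exists_mul_eq (P.d m) (g m * Q.d m) (fun x => by
        rw [← Matrix.mulVec_mulVec]
        cases m with
        | zero =>
          refine (hP.aug_mem _).1 ?_
          have := I.add_mem (hg2 (Q.d 0 *ᵥ x)) (hJI ((hQ.aug_mem _).2 ⟨x, rfl⟩))
          simpa using this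
        | succ m =>
          refine (hP.exact m _).1 ?_
          rw [Matrix.mulVec_mulVec, ← hg1 m (by omega), ← Matrix.mulVec_mulVec,
            (hQ.exact m _).2 ⟨x, rfl⟩, Matrix.mulVec_zero])
      refine ⟨Function.update g (m + 1) S, ?_, ?_⟩
      · intro i hi
        rw [Function.update_of_ne (by omega)]
        rcases Nat.lt_succ_iff_lt_or_eq.1 hi with hi | rfl
        · rw [Function.update_of_ne (by omega)]
          exact hg1 i hi
        · simp [hS]
      · rw [Function.update_of_ne (by omega)]
        exact hg2
  obtain ⟨g, hg1, hg2⟩ := key h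
  refine ⟨g, fun i => ?_, hg2⟩
  by_cases hi : i < h
  · exact hg1 i hi
  · have := hQ.isEmpty (i := i + 1) (by omega)
    ext a b
    exact isEmptyElim b

end MatComplex

end

section

open Matrix

namespace MvPowerSeries

variable {n : ℕ} {k : Type} [Field k]

theorem mem_span_X_pow (S : Finset (Fin n)) (a : ℕ) (f : MvPowerSeries (Fin n) k)
    (hf : ∀ m : Fin n →₀ ℕ, (∀ i ∈ S, m i < a) → coeff m f = 0) :
    f ∈ Ideal.span ((fun i => (X i : MvPowerSeries (Fin n) k) ^ a) '' S) := by
  classical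
  induction S using Finset.induction_on generalizing f with
  | empty =>
    have : f = 0 := by ext m; simpa using hf m
    simp [this]
  | insert i S hi ih =>
    let f1 : MvPowerSeries (Fin n) k := fun m => if m i < a then 0 else coeff m f
    let f2 : MvPowerSeries (Fin n) k := fun m => if m i < a then coeff m f else 0
    have c1 (m) : coeff m f1 = if m i < a then 0 else coeff m f := rfl
    have c2 (m) : coeff m f2 = if m i < a then coeff m f else 0 := rfl
    have hsum : f = f1 + f2 := by
      ext m
      rw [map_add, c1, c2]
      split_ifs <;> simp
    have h1 : (X i : MvPowerSeries (Fin n) k) ^ a ∣ f1 :=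
      X_pow_dvd_iff.2 fun m hm => by rw [c1, if_pos hm]
    have h2 := ih f2 fun m hm => by
      rw [c2]
      split_ifs with h
      · exact hf m (by simpa [h] using hm)
      · rfl
    rw [hsum]
    refine add_mem (Ideal.mem_of_dvd _ h1 (Ideal.subset_span ⟨i, by simp, rfl⟩))
      (Ideal.span_mono (Set.image_mono (by simp)) h2)

theorem X_mem_maximalIdeal (i : Fin n) :
    (X i : MvPowerSeries (Fin n) k) ∈ IsLocalRing.maximalIdeal (MvPowerSeries (Fin n) k) := by
  rw [IsLocalRing.mem_maximalIdeal, mem_nonunits_iff, isUnit_iff_constantCoeff]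
  simp

theorem mem_maximalIdeal_pow (N : ℕ) (f : MvPowerSeries (Fin n) k)
    (hf : ∀ m : Fin n →₀ ℕ, (∀ i, m i < N) → coeff m f = 0) :
    f ∈ IsLocalRing.maximalIdeal (MvPowerSeries (Fin n) k) ^ N := by
  refine Ideal.span_le.2 ?_ (mem_span_X_pow Finset.univ N f (by simpa using hf))
  rintro _ ⟨i, -, rfl⟩
  exact Ideal.pow_mem_pow (X_mem_maximalIdeal i) N

variable (p : ℕ) [hp : Fact p.Prime] [CharP k p] (e : ℕ)

theorem coeff_smul_pow (r : MvPowerSeries (Fin n) k) (m : Fin n →₀ ℕ) :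
    coeff (p ^ e • m) (r ^ p ^ e) = coeff m r ^ p ^ e := by
  rw [← map_iterateFrobenius_expand p hp.1.ne_zero, coeff_map, coeff_expand_smul,
    iterateFrobenius_def]

theorem coeff_pow_of_not_dvd (r : MvPowerSeries (Fin n) k) (m : Fin n →₀ ℕ) (i)
    (hi : ¬ p ^ e ∣ m i) : coeff m (r ^ p ^ e) = 0 := by
  rw [← map_iterateFrobenius_expand p hp.1.ne_zero, coeff_map,
    coeff_expand_of_not_dvd _ _ _ hi, map_zero]

/-- An additive operator that is linear with respect to multiplication by `q`-th powers. -/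
noncomputable def frobTrace (q : ℕ) (lam : k →+ k) (α : Fin n →₀ ℕ) (s : MvPowerSeries (Fin n) k) :
    MvPowerSeries (Fin n) k := fun γ => lam (coeff (q • γ + α) s)

theorem coeff_frobTrace (q : ℕ) (lam : k →+ k) (α γ : Fin n →₀ ℕ) (s : MvPowerSeries (Fin n) k) :
    coeff γ (frobTrace q lam α s) = lam (coeff (q • γ + α) s) := rfl

theorem frobTrace_sum (q : ℕ) (lam : k →+ k) (α : Fin n →₀ ℕ) {ι : Type} (t : Finset ι)
    (s : ι → MvPowerSeries (Fin n) k) :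
    frobTrace q lam α (∑ i ∈ t, s i) = ∑ i ∈ t, frobTrace q lam α (s i) := by
  ext γ
  simp [coeff_frobTrace]

theorem frobTrace_pow_mul (lam : k →+ k) (hlam : ∀ c d, lam (c ^ p ^ e * d) = c * lam d)
    (α : Fin n →₀ ℕ) (hα : ∀ i, α i < p ^ e) (r s : MvPowerSeries (Fin n) k) :
    frobTrace (p ^ e) lam α (r ^ p ^ e * s) = r * frobTrace (p ^ e) lam α s := by
  classical
  have hq : 0 < p ^ e := pow_pos hp.1.pos e
  ext γ
  rw [coeff_frobTrace, coeff_mul, coeff_mul, map_sum]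
  symm
  refine Finset.sum_bij_ne_zero (fun x _ _ => (p ^ e • x.1, p ^ e • x.2 + α)) ?_ ?_ ?_ ?_
  · rintro ⟨a, b⟩ hab -
    rw [Finset.HasAntidiagonal.mem_antidiagonal] at hab ⊢
    simp only at hab ⊢
    rw [← hab, smul_add, add_assoc]
  · rintro ⟨a, b⟩ _ _ ⟨a', b'⟩ _ _ h
    simp only [Prod.mk.injEq, add_left_inj] at h ⊢
    exact ⟨smul_right_injective _ hq.ne' h.1, smul_right_injective _ hq.ne' h.2⟩
  · rintro ⟨a, b⟩ hab hne
    rw [Finset.HasAntidiagonal.mem_antidiagonal] at hab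
    simp only at hab hne
    have hdvd : ∀ i, p ^ e ∣ a i := fun i => by
      by_contra hi
      exact hne (by rw [coeff_pow_of_not_dvd p e r a i hi, zero_mul, map_zero])
    have key : ∀ i, a i / p ^ e ≤ γ i ∧ a i = p ^ e * (a i / p ^ e) := fun i => by
      obtain ⟨c, hc⟩ := hdvd i
      have := DFunLike.congr_fun hab i
      simp only [Finsupp.add_apply, Finsupp.smul_apply, smul_eq_mul] at this
      have h2 := hα i
      rw [hc, Nat.mul_div_cancel_left _ hq]
      refine ⟨?_, rfl⟩
      by_contra hlt
      have : p ^ e * (γ i + 1) ≤ p ^ e * c := Nat.mul_le_mul_left _ (by omega)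
      rw [mul_add] at this
      omega
    let a' : Fin n →₀ ℕ := Finsupp.equivFunOnFinite.symm fun i => a i / p ^ e
    have ha : a = p ^ e • a' := by
      ext i
      exact (key i).2
    have hle : a' ≤ γ := fun i => (key i).1
    have hb : b = p ^ e • (γ - a') + α := by
      have : p ^ e • a' + b = p ^ e • a' + (p ^ e • (γ - a') + α) := by
        rw [← ha, hab, ← add_assoc, ha, ← smul_add, add_tsub_cancel_of_le hle]
      exact add_left_cancel this
    refine ⟨(a', γ - a'), by simpa using add_tsub_cancel_of_le hle, ?_, by rw [ha, hb]⟩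
    rwa [ha, hb, coeff_smul_pow, hlam] at hne
  · rintro ⟨a, b⟩ _ _
    rw [coeff_smul_pow, hlam, coeff_frobTrace]

theorem exists_frob_coords (C : Finset k) :
    ∃ (ι : Type) (S : Finset ι) (b : ι → k) (lam : ι → k →+ k),
      (∀ i c d, lam i (c ^ p ^ e * d) = c * lam i d) ∧
      ∀ c ∈ C, c = ∑ i ∈ S, b i * lam i c ^ p ^ e := by
  classical
  let F := iterateFrobenius k p e
  let K := F.fieldRange
  let φ : k ≃+* K := RingEquiv.ofBijective F.rangeRestrictField
    ⟨F.rangeRestrictField.injective, by rintro ⟨_, x, rfl⟩; exact ⟨x, rfl⟩⟩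
  have hφ (x : k) : (φ x : k) = x ^ p ^ e := by
    show F x = _
    rw [iterateFrobenius_def]
  have hφ' (y : K) : (φ.symm y) ^ p ^ e = (y : k) := by
    rw [← hφ, φ.apply_symm_apply]
  let B := Module.Basis.ofVectorSpace K k
  refine ⟨_, C.biUnion fun c => (B.repr c).support, B,
    fun i => (φ.symm : K →+ k).comp ((B.coord i : k →+ K)), ?_, ?_⟩
  · intro i c d
    have : c ^ p ^ e * d = φ c • d := by
      rw [← hφ]; rfl
    simp [this]
  · intro c hc
    conv_lhs => rw [← B.linearCombination_repr c]
    rw [Finsupp.linearCombination_apply, Finsupp.sum_of_support_subset _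
      (Finset.subset_biUnion_of_mem (fun c => (B.repr c).support) hc) _ (by simp)]
    refine Finset.sum_congr rfl fun i _ => ?_
    have : ((φ.symm : K →+ k).comp ((B.coord i : k →+ K))) c = φ.symm (B.repr c i) := rfl
    rw [this, hφ', mul_comm]
    rfl

/-- Flatness of Frobenius in equational form. -/
theorem mem_span_pow_of_mulVec {a b : Type} [Fintype b]
    (M : Matrix a b (MvPowerSeries (Fin n) k)) (s : b → MvPowerSeries (Fin n) k)
    (hs : M.map (· ^ p ^ e) *ᵥ s = 0) :
    s ∈ Submodule.span (MvPowerSeries (Fin n) k)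
      ((fun t i => t i ^ p ^ e) '' {t : b → MvPowerSeries (Fin n) k | M *ᵥ t = 0}) := by
  classical
  let R := MvPowerSeries (Fin n) k
  let W := Submodule.span R ((fun t i => t i ^ p ^ e) '' {t : b → R | M *ᵥ t = 0})
  have hq : 0 < p ^ e := pow_pos hp.1.pos e
  have key : ∀ N : ℕ, ∃ w ∈ W, s - w ∈
      (IsLocalRing.maximalIdeal R ^ N • ⊤ : Submodule R (b → R)) := by
    intro N
    let box (N : ℕ) : Finset (Fin n →₀ ℕ) :=
      Finset.Iic (Finsupp.equivFunOnFinite.symm fun _ => N)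
    obtain ⟨ι, S, β, lam, hlam, hC⟩ := exists_frob_coords (k := k) p e
      ((Finset.univ ×ˢ box N).image fun jm => coeff jm.2 (s jm.1))
    let A := box (p ^ e - 1)
    have hA (α) : α ∈ A ↔ ∀ i, α i < p ^ e := by
      simp only [A, box, Finset.mem_Iic, Finsupp.le_def]
      refine forall_congr' fun i => ?_
      simp only [Finsupp.coe_equivFunOnFinite_symm]
      omega
    let t (i : ι) (α : Fin n →₀ ℕ) : b → R := fun j => frobTrace (p ^ e) (lam i) α (s j)
    have ht (i : ι) (α) (hα : α ∈ A) : M *ᵥ t i α = 0 := by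
      ext1 r
      have h1 := congrFun hs r
      simp only [Matrix.mulVec, dotProduct, Matrix.map_apply, Pi.zero_apply, t] at h1 ⊢
      have h2 := congrArg (frobTrace (p ^ e) (lam i) α) h1
      rw [frobTrace_sum] at h2
      simp only [frobTrace_pow_mul p e (lam i) (hlam i) α ((hA α).1 hα)] at h2
      rw [h2]
      ext γ
      simp [coeff_frobTrace]
    refine ⟨∑ i ∈ S, ∑ α ∈ A, monomial α (β i) • (fun j => t i α j ^ p ^ e),
      Submodule.sum_mem _ fun i _ => Submodule.sum_mem _ fun α hα => Submodule.smul_mem _ _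
        (Submodule.subset_span ⟨t i α, ht i α hα, rfl⟩), ?_⟩
    set w := ∑ i ∈ S, ∑ α ∈ A, monomial α (β i) • (fun j => t i α j ^ p ^ e) with hw
    have hent : ∀ j, (s - w) j ∈ IsLocalRing.maximalIdeal R ^ N := by
      intro j
      refine mem_maximalIdeal_pow N _ fun m hm => ?_
      let α₀ : Fin n →₀ ℕ := Finsupp.equivFunOnFinite.symm fun i => m i % p ^ e
      let γ₀ : Fin n →₀ ℕ := Finsupp.equivFunOnFinite.symm fun i => m i / p ^ e
      have hm0 : m = p ^ e • γ₀ + α₀ := by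
        ext i
        simp [α₀, γ₀, Nat.div_add_mod]
      have hwj : coeff m (w j) = ∑ i ∈ S, β i * lam i (coeff m (s j)) ^ p ^ e := by
        simp only [hw, Finset.sum_apply, Pi.smul_apply, smul_eq_mul, map_sum]
        refine Finset.sum_congr rfl fun i _ => ?_
        rw [Finset.sum_eq_single α₀]
        · conv_lhs => rw [hm0, add_comm]
          rw [coeff_add_monomial_mul, coeff_smul_pow, coeff_frobTrace, ← hm0]
        · intro α hα hne
          rw [coeff_monomial_mul]
          split_ifs with hle
          · obtain ⟨i', hi'⟩ : ∃ i', α i' ≠ α₀ i' := by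
              by_contra! h
              exact hne (Finsupp.ext h)
            rw [coeff_pow_of_not_dvd p e _ _ i', mul_zero]
            rintro ⟨c, hc⟩
            apply hi'
            have h1 : m i' = α i' + p ^ e * c := by
              have := hle i'
              rw [Finsupp.tsub_apply] at hc
              omega
            simp only [α₀, Finsupp.coe_equivFunOnFinite_symm]
            rw [h1, Nat.add_mul_mod_self_left, Nat.mod_eq_of_lt ((hA α).1 hα i')]
          · rfl
        · intro h
          refine absurd ((hA _).2 fun i => ?_) h
          exact Nat.mod_lt _ hq
      rw [Pi.sub_apply, map_sub, hwj, sub_eq_zero]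
      refine hC _ (Finset.mem_image.2 ⟨(j, m), ?_, rfl⟩)
      simp only [Finset.mem_product, Finset.mem_univ, true_and, box, Finset.mem_Iic]
      intro i
      exact (hm i).le
    have : s - w = ∑ j, (s - w) j • (Pi.single j 1 : b → R) := by
      ext1 j
      simp [Finset.sum_apply, Pi.single_apply]
    rw [this]
    exact Submodule.sum_mem _ fun j _ => Submodule.smul_mem_smul (hent j) trivial
  have h0 : W.mkQ s ∈ (⨅ i : ℕ, IsLocalRing.maximalIdeal R ^ i • ⊤ :
      Submodule R ((b → R) ⧸ W)) := by
    rw [Submodule.mem_iInf]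
    intro N
    obtain ⟨w, hw, hsw⟩ := key N
    have h1 : W.mkQ s = W.mkQ (s - w) := by
      rw [map_sub, (Submodule.Quotient.mk_eq_zero W).2 hw |> fun h => (h : W.mkQ w = 0), sub_zero]
    rw [h1]
    have h2 := Submodule.mem_map_of_mem (f := W.mkQ) hsw
    rw [Submodule.map_smul''] at h2
    exact Submodule.smul_mono le_rfl le_top h2
  rw [Ideal.iInf_pow_smul_eq_bot_of_isLocalRing _ (Ideal.IsPrime.ne_top'), Submodule.mem_bot] at h0
  exact (Submodule.Quotient.mk_eq_zero W).1 h0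

end MvPowerSeries

end

section

open Matrix

namespace MatComplex

variable {R : Type} [CommRing R]

/-- Equational flatness of an endomorphism. -/
def EqFlat (φ : R →+* R) : Prop :=
  ∀ (a b : Type) [Fintype b] (M : Matrix a b R) (s : b → R), M.map φ *ᵥ s = 0 →
    s ∈ Submodule.span R ((fun t i => φ (t i)) '' {t : b → R | M *ᵥ t = 0})

theorem EqFlat.mem_span_of_dotProduct_mem [IsNoetherianRing R] {φ : R →+* R} (hφ : EqFlat φ)
    (I : Ideal R) {b : Type} [Fintype b] (c s : b → R)
    (hs : (fun i => φ (c i)) ⬝ᵥ s ∈ I.map φ) :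
    s ∈ Submodule.span R ((fun t i => φ (t i)) '' {t : b → R | c ⬝ᵥ t ∈ I}) := by
  obtain ⟨m, f, hf⟩ := Submodule.fg_iff_exists_fin_generating_family.1
    (IsNoetherian.noetherian I)
  have hf' : Ideal.span (Set.range f) = I := hf
  rw [← hf', Ideal.map_span, ← Set.range_comp, Ideal.mem_span_range_iff_exists_fun] at hs
  obtain ⟨w, hw⟩ := hs
  have h1 := hφ Unit (b ⊕ Fin m) (Matrix.of fun _ => Sum.elim c f) (Sum.elim s (-w)) (by
    ext i
    simp only [Matrix.mulVec, dotProduct, Matrix.map_apply, Matrix.of_apply,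
      Fintype.sum_sum_type, Sum.elim_inl, Sum.elim_inr, Pi.neg_apply, Pi.zero_apply]
    simp only [mul_neg, Finset.sum_neg_distrib]
    rw [← sub_eq_add_neg, sub_eq_zero]
    simp only [Function.comp_apply, dotProduct] at hw
    rw [← hw]
    exact Finset.sum_congr rfl fun i _ => mul_comm _ _)
  have h2 := Submodule.mem_map_of_mem (f := LinearMap.funLeft R R (Sum.inl : b → b ⊕ Fin m)) h1
  rw [Submodule.map_span] at h2
  have h3 : LinearMap.funLeft R R (Sum.inl : b → b ⊕ Fin m) (Sum.elim s (-w)) = s := rfl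
  rw [h3] at h2
  refine Submodule.span_mono ?_ h2
  rintro _ ⟨_, ⟨t, ht, rfl⟩, rfl⟩
  refine ⟨fun i => t (Sum.inl i), ?_, rfl⟩
  have h4 : (Matrix.of fun _ => Sum.elim c f : Matrix Unit (b ⊕ Fin m) R) *ᵥ t = 0 := ht
  have h5 := congrFun h4 ()
  simp only [Matrix.mulVec, dotProduct, Matrix.of_apply,
      Fintype.sum_sum_type, Sum.elim_inl, Sum.elim_inr, Pi.zero_apply] at h5
  show ∑ i, c i * t (Sum.inl i) ∈ I
  rw [eq_neg_of_add_eq_zero_left h5]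
  refine neg_mem (Submodule.sum_mem _ fun i _ => I.mul_mem_right _ ?_)
  rw [← hf']
  exact Ideal.subset_span ⟨i, rfl⟩

theorem EqFlat.mem_map_of_mul_mem [IsNoetherianRing R] {φ : R →+* R} (hφ : EqFlat φ)
    {I : Ideal R} {c : R} (hc : ∀ r, c * r ∈ I → r ∈ I) (r : R) (hr : φ c * r ∈ I.map φ) :
    r ∈ I.map φ := by
  have h1 := hφ.mem_span_of_dotProduct_mem I (fun _ : Unit => c) (fun _ => r)
    (by simpa [dotProduct] using hr)
  have h2 := Submodule.mem_map_of_mem (f := LinearMap.proj (R := R) (φ := fun _ : Unit => R) ()) h1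
  rw [Submodule.map_span] at h2
  refine Submodule.span_le.2 ?_ h2
  rintro _ ⟨_, ⟨t, ht, rfl⟩, rfl⟩
  exact Ideal.mem_map_of_mem φ (hc _ (by simpa [dotProduct] using ht))

theorem EqFlat.exists_mulVec {φ : R →+* R} (hφ : EqFlat φ) {l a b : Type} [Fintype a] [Fintype b]
    (M : Matrix l a R) (N : Matrix a b R)
    (H : ∀ x, M *ᵥ x = 0 → ∃ y, N *ᵥ y = x) (x : a → R) (hx : M.map φ *ᵥ x = 0) :
    ∃ y, N.map φ *ᵥ y = x := by
  suffices x ∈ LinearMap.range (N.map φ).mulVecLin from this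
  refine Submodule.span_le.2 ?_ (hφ _ _ M x hx)
  rintro _ ⟨t, ht, rfl⟩
  obtain ⟨y, rfl⟩ := H t ht
  exact ⟨φ ∘ y, by ext i; simp [RingHom.map_mulVec]⟩

/-- Base change along an endomorphism. -/
abbrev map (φ : R →+* R) (P : MatComplex R) : MatComplex R where
  rk := P.rk
  d i := (P.d i).map φ
  aug i := φ (P.aug i)

variable {φ : R →+* R} {P : MatComplex R} {I : Ideal R} {h : ℕ}

theorem cobd_map (φ : R →+* R) (P : MatComplex R) (i : ℕ) :
    (P.map φ).cobd i =
      Submodule.span R ((fun (t : Fin (P.rk i) → R) j => φ (t j)) ''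
        (P.cobd i : Set (Fin (P.rk i) → R))) := by
  cases i with
  | zero =>
    show ⊥ = Submodule.span R ((fun (t : Fin (P.rk 0) → R) j => φ (t j)) ''
      ((⊥ : Submodule R (Fin (P.rk 0) → R)) : Set (Fin (P.rk 0) → R)))
    rw [eq_comm, Submodule.span_eq_bot]
    rintro _ ⟨_, rfl, rfl⟩
    ext i
    simp
  | succ i =>
    apply le_antisymm
    · rintro _ ⟨y, rfl⟩
      have : (P.map φ).d i = (P.d i).map φ := rfl
      rw [Matrix.vecMulLinear_apply, this, Matrix.vecMul_eq_sum]
      refine Submodule.sum_mem _ fun j _ => Submodule.smul_mem _ _ (Submodule.subset_span ?_)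
      exact ⟨P.d i j, ⟨Pi.single j 1, by simp; rfl⟩, rfl⟩
    · rw [Submodule.span_le]
      rintro _ ⟨_, ⟨y, rfl⟩, rfl⟩
      refine ⟨φ ∘ y, ?_⟩
      ext j
      rw [Matrix.vecMulLinear_apply, Matrix.vecMulLinear_apply]
      exact (RingHom.map_vecMul φ (P.d i) y j).symm

theorem IsRes.map [IsNoetherianRing R] (hP : P.IsRes I h) (hφ : EqFlat φ) :
    (P.map φ).IsRes (I.map φ) h where
  aug_mem x := by
    constructor
    · intro hx
      have h1 := hφ.mem_span_of_dotProduct_mem I P.aug x hx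
      suffices x ∈ LinearMap.range ((P.d 0).map φ).mulVecLin from this
      refine Submodule.span_le.2 ?_ h1
      rintro _ ⟨t, ht, rfl⟩
      obtain ⟨y, rfl⟩ := (hP.aug_mem t).1 ht
      exact ⟨φ ∘ y, by ext i; simp [RingHom.map_mulVec]⟩
    · rintro ⟨y, rfl⟩
      show (φ ∘ P.aug) ⬝ᵥ ((P.d 0).map φ *ᵥ y) ∈ _
      rw [Matrix.dotProduct_mulVec]
      refine Submodule.sum_mem _ fun j _ => Ideal.mul_mem_right _ _ ?_
      rw [← RingHom.map_vecMul]
      refine Ideal.mem_map_of_mem _ ?_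
      have := (hP.aug_mem _).2 ⟨Pi.single j 1, rfl⟩
      rw [Matrix.dotProduct_mulVec] at this
      simpa using this
  aug_surj := by
    obtain ⟨x, hx⟩ := hP.aug_surj
    refine ⟨φ ∘ x, ?_⟩
    have := Ideal.mem_map_of_mem φ hx
    rw [map_sub, map_one, RingHom.map_dotProduct] at this
    exact this
  exact i x := by
    constructor
    · exact hφ.exists_mulVec _ _ (fun x hx => (hP.exact i x).1 hx) x
    · rintro ⟨y, rfl⟩
      show (P.d i).map φ *ᵥ ((P.d (i + 1)).map φ *ᵥ y) = 0
      rw [Matrix.mulVec_mulVec, ← Matrix.map_mul, hP.d_mul_d]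
      simp
  rk_top := hP.rk_top
  dual_exact i hi z hz := by
    rw [cobd_map]
    refine Submodule.span_mono ?_ (hφ _ _ (P.d i)ᵀ z ?_)
    · refine Set.image_mono fun t ht => hP.dual_exact i hi t ?_
      simpa [Matrix.mulVec_transpose] using ht
    · rw [Matrix.transpose_map, Matrix.mulVec_transpose]
      exact hz

/-- `c` presents `Ω ⧸ I` by top cohomology of the transpose of `P`. -/
structure IsPres (P : MatComplex R) (I Ω : Ideal R) (h : ℕ) (c : Fin (P.rk h) → R) : Prop where
  mem_iff : ∀ z, z ⬝ᵥ c ∈ I ↔ z ∈ P.cobd h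
  eq_sup : Ω = I ⊔ Ideal.span (Set.range c)

theorem IsPres.map [IsNoetherianRing R] {Ω : Ideal R} {c} (hc : P.IsPres I Ω h c)
    (hφ : EqFlat φ) : (P.map φ).IsPres (I.map φ) (Ω.map φ) h (φ ∘ c) where
  mem_iff z := by
    constructor
    · intro hz
      rw [dotProduct_comm] at hz
      rw [cobd_map]
      refine Submodule.span_mono ?_ (hφ.mem_span_of_dotProduct_mem I c z hz)
      refine Set.image_mono fun t ht => (hc.mem_iff t).1 ?_
      rw [dotProduct_comm]; exact ht
    · intro hz
      rw [cobd_map] at hz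
      refine Submodule.span_induction (p := fun z _ => z ⬝ᵥ (φ ∘ c) ∈ I.map φ) ?_ ?_ ?_ ?_ hz
      · rintro _ ⟨t, ht, rfl⟩
        have := Ideal.mem_map_of_mem φ ((hc.mem_iff t).2 ht)
        rw [RingHom.map_dotProduct] at this
        exact this
      · rw [zero_dotProduct]; exact zero_mem _
      · intro x y _ _ hx hy
        rw [add_dotProduct]; exact add_mem hx hy
      · intro a x _ hx
        rw [smul_dotProduct]; exact Ideal.mul_mem_left _ _ hx
  eq_sup := by
    rw [hc.eq_sup, Ideal.map_sup, Ideal.map_span, Set.range_comp]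

variable {Q : MatComplex R} {J : Ideal R}

theorem isChainMap_one (P : MatComplex R) : IsChainMap P P (fun _ => 1) := fun i => by simp

theorem IsChainMap.sub_smul {g g' : ∀ i, Matrix (Fin (P.rk i)) (Fin (Q.rk i)) R}
    (hg : IsChainMap Q P g) (hg' : IsChainMap Q P g') (a : R) :
    IsChainMap Q P (fun i => g i - a • g' i) := fun i => by
  rw [Matrix.sub_mul, Matrix.mul_sub, hg i, Matrix.smul_mul, hg' i, Matrix.mul_smul]

/-- Chain maps are scalar multiples of a lift of the projection, on top cohomology. -/
theorem IsChainMap.exists_smul (hP : P.IsRes I h) (hQ : Q.IsRes J h) {g π}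
    (hg : IsChainMap Q P g) (hπ : IsChainMap Q P π)
    (hπ0 : ∀ x, P.aug ⬝ᵥ (π 0 *ᵥ x) - Q.aug ⬝ᵥ x ∈ I) :
    ∃ a : R, ∀ z, z ᵥ* (g h - a • π h) ∈ Q.cobd h := by
  obtain ⟨x1, hx1⟩ := hQ.aug_surj
  refine ⟨P.aug ⬝ᵥ (g 0 *ᵥ x1), IsChainMap.top_mem_cobd hP hQ (hg.sub_smul hπ _) fun x => ?_⟩
  set a := P.aug ⬝ᵥ (g 0 *ᵥ x1)
  obtain ⟨y, hy⟩ := (hQ.aug_mem (x - (Q.aug ⬝ᵥ x) • x1)).1 (by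
    have := J.mul_mem_left (-(Q.aug ⬝ᵥ x)) hx1
    rw [dotProduct_sub, dotProduct_smul, smul_eq_mul]
    convert this using 1
    ring)
  have hy' := (hP.aug_mem _).2 ⟨g 1 *ᵥ y, rfl⟩
  rw [Matrix.mulVec_mulVec, ← hg 0, ← Matrix.mulVec_mulVec, hy, Matrix.mulVec_sub,
    Matrix.mulVec_smul, dotProduct_sub, dotProduct_smul, smul_eq_mul] at hy'
  have := I.sub_mem hy' (I.mul_mem_left a (hπ0 x))
  rw [Matrix.sub_mulVec, Matrix.smul_mulVec, dotProduct_sub, dotProduct_smul, smul_eq_mul]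
  convert this using 1
  ring

theorem exists_mulVec_sub_mem {Ω : Ideal R} {m l : Type} [Fintype m] {c : m → R}
    (hΩ : Ω = I ⊔ Ideal.span (Set.range c)) (b : l → R) (hb : ∀ j, b j ∈ Ω) :
    ∃ W : Matrix l m R, ∀ j, b j - (W *ᵥ c) j ∈ I := by
  have : ∀ j, ∃ w : m → R, b j - w ⬝ᵥ c ∈ I := fun j => by
    have h1 := hb j
    rw [hΩ, Submodule.mem_sup] at h1
    obtain ⟨i, hi, y, hy, hiy⟩ := h1
    obtain ⟨w, rfl⟩ := Ideal.mem_span_range_iff_exists_fun.1 hy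
    refine ⟨w, ?_⟩
    rw [← hiy]
    simpa [dotProduct] using hi
  choose W hW using this
  exact ⟨W, hW⟩

theorem dotProduct_mem {m : Type} [Fintype m] (z b : m → R) (hb : ∀ j, b j ∈ I) : z ⬝ᵥ b ∈ I :=
  Submodule.sum_mem _ fun j _ => I.mul_mem_left _ (hb j)

/-- The generator of the colon ideals computes the map on canonical modules induced by the
projection `R ⧸ I.map φ → R ⧸ I`, up to a unit. -/
theorem exists_unit_smul_sub_mem [IsNoetherianRing R] [IsLocalRing R] (hφ : EqFlat φ)
    (hdvd : ∀ x, x ∣ φ x) (hP : P.IsRes I h) {Ω : Ideal R} {c} (hc : P.IsPres I Ω h c)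
    (y : Fin (P.rk h) → R) (hy : ∀ r, (y ⬝ᵥ c) * r ∈ I → r ∈ I)
    {π} (hπ : IsChainMap (P.map φ) P π)
    (hπ0 : ∀ x, P.aug ⬝ᵥ (π 0 *ᵥ x) - (P.map φ).aug ⬝ᵥ x ∈ I)
    (u : R) (hu : Submodule.colon (I.map φ) I ⊓ Submodule.colon (Ω.map φ) Ω =
      I.map φ ⊔ Ideal.span {u}) :
    ∃ a : R, IsUnit a ∧ ∀ j, a * u * c j - (π h *ᵥ (φ ∘ c)) j ∈ I.map φ := by
  have hmap (K : Ideal R) : K.map φ ≤ K := Ideal.map_le_iff_le_comap.2 fun x hx =>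
    K.mem_of_dvd (hdvd x) hx
  have hP' := hP.map hφ
  have hc' := hc.map hφ
  set I' := I.map φ
  set c' := φ ∘ c
  set ψ := π h *ᵥ c' with hψ
  have star (z) (hz : z ⬝ᵥ c ∈ I) : z ⬝ᵥ ψ ∈ I' := by
    rw [hψ, Matrix.dotProduct_mulVec]
    exact (hc'.mem_iff _).2 (hπ.mem_cobd h ((hc.mem_iff z).1 hz))
  have hIΩ : I ≤ Ω := by rw [hc.eq_sup]; exact le_sup_left
  have hcΩ (j) : c j ∈ Ω := by
    rw [hc.eq_sup]; exact Ideal.mem_sup_right (Ideal.subset_span ⟨j, rfl⟩)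
  have hI'Ω' : I' ≤ Ω.map φ := Ideal.map_mono hIΩ
  have hψΩ (j) : ψ j ∈ Ω.map φ :=
    dotProduct_mem _ _ fun i => Ideal.mem_map_of_mem φ (hcΩ i)
  obtain ⟨W, hW⟩ := exists_mulVec_sub_mem hc.eq_sup c'
    fun j => hmap _ (Ideal.mem_map_of_mem φ (hcΩ j))
  have hWz (z) : z ⬝ᵥ c' - z ⬝ᵥ (W *ᵥ c) ∈ I := by
    rw [← dotProduct_sub]; exact dotProduct_mem _ _ hW
  set c0 := y ⬝ᵥ c
  have hc0 : φ c0 = (φ ∘ y) ⬝ᵥ c' := RingHom.map_dotProduct ..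
  have hreg (r) (hr : φ c0 * r ∈ I') : r ∈ I' := hφ.mem_map_of_mul_mem hy r hr
  have hregc (r) (hr : ∀ j, r * c j ∈ I') : r ∈ I' := by
    refine hreg r ?_
    obtain ⟨b, hb⟩ := hdvd c0
    have : φ c0 * r = b * (y ⬝ᵥ fun j => r * c j) := by
      have : (fun j => r * c j) = r • c := rfl
      rw [this, dotProduct_smul, hb, smul_eq_mul]; ring
    rw [this]
    exact I'.mul_mem_left _ (dotProduct_mem _ _ hr)
  obtain ⟨v, hv⟩ : ∃ v, ∀ j, (W *ᵥ ψ) j - v * c' j ∈ I' := by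
    obtain ⟨g, hg, hgh⟩ := exists_chainMap_of_top hP' hP' (W * π h) (fun z hz => by
      rw [← hc'.mem_iff] at hz ⊢
      rw [← Matrix.dotProduct_mulVec, ← Matrix.mulVec_mulVec, Matrix.dotProduct_mulVec]
      refine star _ ?_
      rw [← Matrix.dotProduct_mulVec]
      have := I.sub_mem (hmap _ hz) (hWz z)
      simpa using this)
    obtain ⟨v, hv⟩ := IsChainMap.exists_smul hP' hP' hg (isChainMap_one _) (by simp)
    refine ⟨v, fun j => ?_⟩
    have := (hc'.mem_iff _).2 (hv (Pi.single j 1))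
    rw [← Matrix.dotProduct_mulVec, hgh, Matrix.sub_mulVec, Matrix.smul_mulVec,
      Matrix.one_mulVec, ← Matrix.mulVec_mulVec, single_dotProduct, one_mul] at this
    exact this
  have hvψ (j) : ψ j - v * c j ∈ I' := by
    refine hreg _ ?_
    have h1 := star (Pi.single j (φ c0) - c j • ((φ ∘ y) ᵥ* W)) (by
      rw [sub_dotProduct, smul_dotProduct, ← Matrix.dotProduct_mulVec, single_dotProduct, hc0]
      have := I.mul_mem_left (c j) (hWz (φ ∘ y))
      convert this using 1
      simp only [smul_eq_mul]; ring)
    rw [sub_dotProduct, smul_dotProduct, ← Matrix.dotProduct_mulVec, single_dotProduct] at h1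
    have h2 : (φ ∘ y) ⬝ᵥ (W *ᵥ ψ - v • c') ∈ I' := dotProduct_mem _ _ hv
    rw [dotProduct_sub, dotProduct_smul, ← hc0] at h2
    have := I'.add_mem h1 (I'.mul_mem_left (c j) h2)
    convert this using 1
    simp only [smul_eq_mul]; ring
  have hvI (i) (hi : i ∈ I) : v * i ∈ I' := by
    refine hregc _ fun j => ?_
    have h1 := star (Pi.single j i) (by
      rw [single_dotProduct]; exact I.mul_mem_right _ hi)
    rw [single_dotProduct] at h1
    have := I'.sub_mem h1 (I'.mul_mem_left i (hvψ j))
    convert this using 1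
    ring
  have hvmem : v ∈ I' ⊔ Ideal.span {u} := by
    rw [← hu]
    refine ⟨?_, ?_⟩
    · exact Submodule.mem_colon.2 fun i hi => hvI i hi
    · refine Submodule.mem_colon.2 fun x hx => ?_
      rw [hc.eq_sup] at hx
      obtain ⟨i, hi, z, hz, rfl⟩ := Submodule.mem_sup.1 hx
      obtain ⟨w, rfl⟩ := Ideal.mem_span_range_iff_exists_fun.1 hz
      rw [smul_eq_mul, mul_add, Finset.mul_sum]
      refine add_mem (hI'Ω' (hvI i hi)) (Submodule.sum_mem _ fun j _ => ?_)
      have := Ideal.mul_mem_left _ (w j) (sub_mem (hψΩ j) (hI'Ω' (hvψ j)))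
      convert this using 1
      ring
  have humem : u ∈ Submodule.colon I' I ⊓ Submodule.colon (Ω.map φ) Ω := by
    rw [hu]; exact Ideal.mem_sup_right (Ideal.mem_span_singleton_self u)
  obtain ⟨b, hb⟩ : ∃ b, u - b * v ∈ I' := by
    obtain ⟨G, hG⟩ := exists_mulVec_sub_mem hc'.eq_sup (u • c)
      fun j => Submodule.mem_colon.1 humem.2 _ (hcΩ j)
    obtain ⟨g, hg, hgh⟩ := exists_chainMap_of_top hP hP' G (fun z hz => by
      rw [← hc.mem_iff] at hz
      rw [← hc'.mem_iff, ← Matrix.dotProduct_mulVec]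
      have h1 : z ⬝ᵥ (u • c - G *ᵥ c') ∈ I' := dotProduct_mem _ _ hG
      rw [dotProduct_sub, dotProduct_smul] at h1
      have := I'.sub_mem (Submodule.mem_colon.1 humem.1 _ hz) h1
      simpa using this)
    obtain ⟨b, hb⟩ := IsChainMap.exists_smul hP hP' hg hπ hπ0
    refine ⟨b, hregc _ fun j => ?_⟩
    have h1 := (hc'.mem_iff _).2 (hb (Pi.single j 1))
    rw [← Matrix.dotProduct_mulVec, hgh, Matrix.sub_mulVec, Matrix.smul_mulVec,
      single_dotProduct, one_mul] at h1
    have h2 := I'.add_mem (I'.add_mem (hG j) h1) (I'.mul_mem_left b (hvψ j))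
    convert h2 using 1
    simp only [Pi.sub_apply, Pi.smul_apply, smul_eq_mul, ← hψ]
    ring
  obtain ⟨i, hi, w, hw, hiw⟩ := Submodule.mem_sup.1 hvmem
  obtain ⟨a, rfl⟩ := Ideal.mem_span_singleton'.1 hw
  obtain ⟨a', ha', hva⟩ : ∃ a', IsUnit a' ∧ v - a' * u ∈ I' := by
    by_cases ha : IsUnit a
    · exact ⟨a, ha, by rw [← hiw]; simpa using hi⟩
    · have h1 : IsUnit (1 - a * b) := by
        refine (IsLocalRing.isUnit_or_isUnit_one_sub_self (a * b)).resolve_left fun h => ha ?_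
        exact isUnit_of_mul_isUnit_left h
      have hv' : v ∈ I' := by
        refine (Ideal.unit_mul_mem_iff_mem I' h1).1 ?_
        have := I'.add_mem hi (I'.mul_mem_left a hb)
        convert this using 1
        rw [← hiw]; ring
      have hu' : u ∈ I' := by
        have := I'.add_mem hb (I'.mul_mem_left b hv')
        simpa using this
      exact ⟨1, isUnit_one, by simpa using I'.sub_mem hv' hu'⟩
  refine ⟨a', ha', fun j => ?_⟩
  have := neg_mem (I'.add_mem (hvψ j) (I'.mul_mem_left (c j) hva))
  convert this using 1
  ring

end MatComplex

end

section

open Matrix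

namespace MatComplex

variable {R : Type} [CommRing R] {P : MatComplex R} {I : Ideal R} {h : ℕ}

/-- An element that maps a canonical ideal into `I` lies in `I`. -/
theorem IsPres.mem_of_forall_mul_mem (hP : P.IsRes I h) {Ω : Ideal R} {c}
    (hc : P.IsPres I Ω h c) {r : R} (hr : ∀ x ∈ Ω, x * r ∈ I) : r ∈ I := by
  have hg : IsChainMap P P (fun _ => r • 1) := fun i => by simp
  have hcΩ : ∀ z, z ⬝ᵥ c ∈ Ω := fun z => by
    rw [hc.eq_sup, dotProduct]
    exact Ideal.sum_mem _ fun j _ => Ideal.mul_mem_left _ _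
      (Ideal.mem_sup_right (Ideal.subset_span ⟨j, rfl⟩))
  obtain ⟨x, hx⟩ := hP.aug_surj
  have h1 := hg.aug_mem_of_top hP hP (fun z => (hc.mem_iff _).1 (by
    have := hr _ (hcΩ z)
    simpa [Matrix.vecMul_smul, smul_dotProduct, mul_comm] using this)) x
  have h2 : P.aug ⬝ᵥ ((r • (1 : Matrix (Fin (P.rk 0)) (Fin (P.rk 0)) R)) *ᵥ x) =
      (P.aug ⬝ᵥ x) * r := by
    simp [Matrix.smul_mulVec, dotProduct_smul, mul_comm]
  rw [h2] at h1
  have := I.sub_mem h1 (I.mul_mem_right r hx)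
  simpa [sub_mul] using this

theorem IsPres.exists_regular [IsNoetherianRing R] (hP : P.IsRes I h) {Ω : Ideal R} {c}
    (hc : P.IsPres I Ω h c) : ∃ y, ∀ r, (y ⬝ᵥ c) * r ∈ I → r ∈ I := by
  obtain ⟨x, hxΩ, hx⟩ : ∃ x ∈ Ω, IsSMulRegular (R ⧸ I) x := by
    by_contra! H
    have hsub : (Ω : Set R) ⊆ ⋃ q ∈ ((associatedPrimes.finite R (R ⧸ I)).toFinset : Set (Ideal R)),
        (q : Set R) := by
      rw [Set.Finite.coe_toFinset, biUnion_associatedPrimes_eq_compl_regular]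
      exact fun x hx => H x hx
    obtain ⟨q, hq, hle⟩ := (Ideal.subset_union_prime (f := fun q : Ideal R => q) ⊥ ⊥
      (fun q hq _ _ => IsAssociatedPrime.isPrime ((Set.Finite.mem_toFinset _).1 hq))).1 hsub
    have hq' : IsAssociatedPrime q (R ⧸ I) := (Set.Finite.mem_toFinset _).1 hq
    obtain ⟨hqp, m, hm⟩ := (isAssociatedPrime_iff).1 hq'
    obtain ⟨r, rfl⟩ := Ideal.Quotient.mk_surjective m
    refine hqp.ne_top (hm.trans ?_)
    have : Ideal.Quotient.mk I r = 0 := by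
      refine Ideal.Quotient.eq_zero_iff_mem.2 (hc.mem_of_forall_mul_mem hP fun x hx => ?_)
      have h1 := hle hx
      rw [hm, Submodule.mem_colon_singleton] at h1
      rw [← Ideal.Quotient.eq_zero_iff_mem]
      simpa [Algebra.smul_def] using h1
    rw [this]
    simp [Ideal.eq_top_iff_one]
  rw [hc.eq_sup] at hxΩ
  obtain ⟨i, hi, w, hw, rfl⟩ := Submodule.mem_sup.1 hxΩ
  obtain ⟨y, rfl⟩ := (Submodule.mem_span_range_iff_exists_fun R).1 hw
  refine ⟨y, fun r hr => ?_⟩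
  rw [← Ideal.Quotient.eq_zero_iff_mem]
  refine hx.right_eq_zero_of_smul ?_
  change Ideal.Quotient.mk I _ = 0
  rw [Ideal.Quotient.eq_zero_iff_mem]
  change (_ + _) * r ∈ I
  rw [add_mul]
  exact I.add_mem (I.mul_mem_right _ hi) hr

end MatComplex

end

section

open CategoryTheory Abelian RingTheory.Sequence Pointwise

namespace ModuleCat

variable {R : Type} [CommRing R]

theorem subsingleton_ext_of_iso {N N' : ModuleCat.{0} R} (e : N ≅ N') (Y : ModuleCat.{0} R) (i : ℕ)
    [Subsingleton (Ext N Y i)] : Subsingleton (Ext N' Y i) := by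
  refine ⟨fun x y => ?_⟩
  have key : ∀ z : Ext N' Y i,
      (Ext.mk₀ e.inv).comp ((Ext.mk₀ e.hom).comp z (zero_add i)) (zero_add i) = z := fun z => by
    simp
  rw [← key x, ← key y, Subsingleton.elim ((Ext.mk₀ e.hom).comp x (zero_add i))]

/-- Vanishing of `Ext` lifts from the quotient by a weakly regular sequence. -/
theorem subsingleton_ext_of_isWeaklyRegular [IsNoetherianRing R] [IsLocalRing R]
    (Y : ModuleCat.{0} R) [Module.Finite R Y] (n : ℕ) (rs : List R)
    (N : Type) [AddCommGroup N] [Module R N] [Module.Finite R N]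
    (mem : ∀ r ∈ rs, r ∈ IsLocalRing.maximalIdeal R) (reg : IsWeaklyRegular N rs)
    (H : ∀ i < n, Subsingleton
      (Ext (ModuleCat.of R (N ⧸ (Ideal.ofList rs • ⊤ : Submodule R N))) Y i)) :
    ∀ i, i + rs.length < n → Subsingleton (Ext (ModuleCat.of R N) Y i) := by
  induction rs generalizing N with
  | nil =>
    intro i hi
    have := H i hi
    exact subsingleton_ext_of_iso (LinearEquiv.toModuleIso (Submodule.quotEquivOfEqBot
      (Ideal.ofList ([] : List R) • ⊤ : Submodule R N) (by rw [Ideal.ofList_nil, Submodule.bot_smul]))) Y i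
  | cons a rs ih =>
    intro i hi
    rw [isWeaklyRegular_cons_iff] at reg
    simp only [List.mem_cons, forall_eq_or_imp] at mem
    rw [List.length_cons] at hi
    have h1 : Subsingleton (Ext (ModuleCat.of R (QuotSMulTop a N)) Y (1 + i)) := by
      refine ih (QuotSMulTop a N) mem.2 reg.2 (fun j hj => ?_) (1 + i) (by omega)
      have := H j hj
      exact subsingleton_ext_of_iso (LinearEquiv.toModuleIso
        (Submodule.quotOfListConsSMulTopEquivQuotSMulTopInner N a rs)) Y j
    have hS : (smulShortComplex (ModuleCat.of R N) a).ShortExact :=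
      IsSMulRegular.smulShortComplex_shortExact (M := ModuleCat.of R N) reg.1
    have h2 : ∀ x : Ext (ModuleCat.of R N) Y i, ∃ y : Ext (ModuleCat.of R N) Y i, a • y = x := by
      intro x
      obtain ⟨y, hy⟩ := Ext.contravariant_sequence_exact₁ hS Y x rfl (h1.elim _ _)
      change Ext (ModuleCat.of R N) Y i at y
      refine ⟨y, Eq.trans ?_ hy⟩
      change _ = (Ext.mk₀ (a • 𝟙 (ModuleCat.of R N))).comp y _
      simp [Ext.mk₀_smul]
    have h3 : (⊤ : Submodule R (Ext (ModuleCat.of R N) Y i)) = ⊥ := by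
      refine Submodule.eq_bot_of_le_smul_of_le_jacobson_bot (Ideal.span {a}) ⊤
        Module.Finite.fg_top (fun x _ => ?_) ?_
      · obtain ⟨y, rfl⟩ := h2 x
        exact Submodule.smul_mem_smul (Ideal.mem_span_singleton_self a) trivial
      · rw [Ideal.span_singleton_le_iff_mem]
        exact IsLocalRing.maximalIdeal_le_jacobson _ mem.1
    exact (Submodule.subsingleton_iff R).1 (subsingleton_of_bot_eq_top h3.symm)

end ModuleCat

end

section

open CategoryTheory RingTheory.Sequence Pointwise

namespace MvPowerSeries

variable {n : ℕ} {k : Type} [Field k]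

theorem mem_span_X_iff (S : Finset (Fin n)) (f : MvPowerSeries (Fin n) k) :
    f ∈ Ideal.span ((fun i => (X i : MvPowerSeries (Fin n) k)) '' S) ↔
      ∀ m : Fin n →₀ ℕ, (∀ i ∈ S, m i = 0) → coeff m f = 0 := by
  classical
  constructor
  · intro hf
    induction hf using Submodule.span_induction with
    | mem x hx =>
      obtain ⟨i, hi, rfl⟩ := hx
      intro m hm
      rw [coeff_X, if_neg]
      rintro rfl
      simpa using hm i hi
    | zero => simp
    | add x y _ _ hx hy => exact fun m hm => by rw [map_add, hx m hm, hy m hm, add_zero]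
    | smul a x _ hx =>
      intro m hm
      rw [smul_eq_mul, coeff_mul]
      refine Finset.sum_eq_zero fun q hq => ?_
      rw [hx, mul_zero]
      intro i hi
      have := hm i hi
      rw [← Finset.HasAntidiagonal.mem_antidiagonal.1 hq, Finsupp.add_apply] at this
      omega
  · intro hf
    simpa using mem_span_X_pow S 1 f (by simpa using hf)

theorem isWeaklyRegular_X :
    IsWeaklyRegular (MvPowerSeries (Fin n) k) (List.ofFn fun i : Fin n => X (R := k) i) := by
  rw [isWeaklyRegular_iff_Fin]
  intro i
  have hi : i.1 < n := by simpa using i.2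
  set S : Finset (Fin n) := Finset.univ.filter fun j => j.1 < i.1
  have hS : (Ideal.ofList ((List.ofFn fun i : Fin n => X (R := k) i).take i.1) • ⊤ :
      Ideal (MvPowerSeries (Fin n) k)) =
        Ideal.span ((fun i => (X i : MvPowerSeries (Fin n) k)) '' S) := by
    rw [smul_eq_mul, Ideal.mul_top, Ideal.ofList]
    congr 1
    ext x
    simp only [List.mem_take_iff_getElem, List.length_ofFn, List.getElem_ofFn, Set.mem_ofPred_eq, S,
      Set.mem_image, Finset.coe_filter, Finset.mem_univ, true_and]
    constructor
    · rintro ⟨j, hj, rfl⟩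
      exact ⟨⟨j, by omega⟩, by simp; omega, rfl⟩
    · rintro ⟨j, hj, rfl⟩
      exact ⟨j.1, by omega, rfl⟩
  rw [hS, isSMulRegular_iff_right_eq_zero_of_smul]
  intro x hx
  obtain ⟨f, rfl⟩ := Ideal.Quotient.mk_surjective x
  have hx' : (X ⟨i.1, hi⟩ : MvPowerSeries (Fin n) k) * f ∈
      Ideal.span ((fun i => (X i : MvPowerSeries (Fin n) k)) '' S) := by
    rw [← Ideal.Quotient.eq_zero_iff_mem]
    rw [Fin.getElem_fin, List.getElem_ofFn] at hx
    exact hx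
  rw [Ideal.Quotient.eq_zero_iff_mem, mem_span_X_iff]
  rw [mem_span_X_iff] at hx'
  intro m hm
  have := hx' (Finsupp.single ⟨i.1, hi⟩ 1 + m) (fun j hj => by
    have h1 := hm j hj
    have h2 : j ≠ ⟨i.1, hi⟩ := by
      rintro rfl
      simp [S] at hj
    simp [h1, Finsupp.single_eq_of_ne h2])
  rw [X, coeff_add_monomial_mul] at this
  simpa using this

theorem ofList_X : Ideal.ofList (List.ofFn fun i : Fin n => X (R := k) i) =
    IsLocalRing.maximalIdeal (MvPowerSeries (Fin n) k) := by
  refine le_antisymm (Ideal.span_le.2 ?_) fun f hf => ?_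
  · intro x hx
    obtain ⟨i, rfl⟩ := (List.mem_ofFn' _ _).1 hx
    exact X_mem_maximalIdeal i
  · have h1 : f ∈ Ideal.span ((fun i => (X i : MvPowerSeries (Fin n) k)) ''
        (Finset.univ : Finset (Fin n))) := by
      rw [mem_span_X_iff]
      intro m hm
      have : m = 0 := by ext i; simpa using hm i
      subst this
      rw [IsLocalRing.mem_maximalIdeal, mem_nonunits_iff, isUnit_iff_constantCoeff] at hf
      simpa using hf
    refine Ideal.span_mono ?_ h1
    rintro _ ⟨i, -, rfl⟩
    exact (List.mem_ofFn' _ _).2 ⟨i, rfl⟩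

theorem isRegular_X :
    IsRegular (MvPowerSeries (Fin n) k) (List.ofFn fun i : Fin n => X (R := k) i) := by
  refine ⟨isWeaklyRegular_X, ?_⟩
  rw [ofList_X, smul_eq_mul, Ideal.mul_top]
  exact (IsLocalRing.maximalIdeal.isMaximal _).ne_top.symm

theorem hasProjectiveDimensionLT_residue :
    HasProjectiveDimensionLT (ModuleCat.of (MvPowerSeries (Fin n) k)
      (MvPowerSeries (Fin n) k ⧸ IsLocalRing.maximalIdeal (MvPowerSeries (Fin n) k))) (n + 1) := by
  have h1 := ModuleCat.projectiveDimension_quotient_eq_length.{0} _ (isRegular_X (n := n) (k := k))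
  rw [ofList_X, List.length_ofFn] at h1
  have h2 := (projectiveDimension_le_iff _ n).1 h1.le
  exact hasProjectiveDimensionLT_of_iso (Shrink.linearEquiv _ _).toModuleIso (n + 1)

theorem hasProjectiveDimensionLT_of_support {N : Type} [AddCommGroup N]
    [Module (MvPowerSeries (Fin n) k) N] [Module.Finite (MvPowerSeries (Fin n) k) N]
    (hN : Module.support (MvPowerSeries (Fin n) k) N ⊆
      PrimeSpectrum.zeroLocus (IsLocalRing.maximalIdeal (MvPowerSeries (Fin n) k))) :
    HasProjectiveDimensionLT (ModuleCat.of (MvPowerSeries (Fin n) k) N) (n + 1) := by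
  induction ‹Module.Finite (MvPowerSeries (Fin n) k) N› using
    IsNoetherianRing.induction_on_isQuotientEquivQuotientPrime (MvPowerSeries (Fin n) k) with
  | subsingleton N =>
    have : Limits.IsZero (ModuleCat.of (MvPowerSeries (Fin n) k) N) :=
      ModuleCat.isZero_of_subsingleton _
    have := this.hasProjectiveDimensionLT_zero
    exact hasProjectiveDimensionLT_of_ge _ 0 (n + 1) (Nat.zero_le _)
  | quotient N q f =>
    have hq : q.asIdeal = IsLocalRing.maximalIdeal (MvPowerSeries (Fin n) k) := by
      have : q ∈ Module.support (MvPowerSeries (Fin n) k) N := by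
        rw [f.support_eq, Module.support_eq_zeroLocus, Ideal.annihilator_quotient]
        exact fun x hx => hx
      exact le_antisymm (IsLocalRing.le_maximalIdeal q.2.ne_top) (hN this)
    have := hasProjectiveDimensionLT_residue (n := n) (k := k)
    rw [← hq] at this
    exact hasProjectiveDimensionLT_of_iso f.symm.toModuleIso (n + 1)
  | exact N₁ N₂ N₃ f g hf hg hfg h1 h3 =>
    let S : ShortComplex (ModuleCat (MvPowerSeries (Fin n) k)) :=
      ShortComplex.mk (ModuleCat.ofHom f) (ModuleCat.ofHom g) (by
        rw [← ModuleCat.ofHom_comp, hfg.linearMap_comp_eq_zero]; rfl)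
    have hS : S.ShortExact :=
      { exact := ShortComplex.Exact.moduleCat_of_range_eq_ker _ _ hfg.linearMap_ker_eq.symm
        mono_f := (ModuleCat.mono_iff_injective _).2 hf
        epi_g := (ModuleCat.epi_iff_surjective _).2 hg }
    exact hS.hasProjectiveDimensionLT_X₂ (n + 1)
      (h1 ((Module.support_subset_of_injective f hf).trans hN))
      (h3 ((Module.support_subset_of_surjective g hg).trans hN))

end MvPowerSeries

end

section

open CategoryTheory RingTheory.Sequence Pointwise

namespace MvPowerSeries

variable {n : ℕ} {k : Type} [Field k]

theorem _root_.List.exists_map_eq_of_forall_mem {α β : Type} (f : α → β) (S : Set α) (l : List β)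
    (h : ∀ x ∈ l, ∃ y ∈ S, f y = x) : ∃ l' : List α, l'.map f = l ∧ ∀ y ∈ l', y ∈ S := by
  induction l with
  | nil => exact ⟨[], by simp⟩
  | cons a l ih =>
    simp only [List.mem_cons, forall_eq_or_imp] at h
    obtain ⟨⟨y, hy, rfl⟩, h⟩ := h
    obtain ⟨l', rfl, h'⟩ := ih h
    exact ⟨y :: l', by simp, by simpa using ⟨hy, h'⟩⟩

theorem projectiveDimension_and_ext_of_isCohenMacaulay {d : ℕ}
    {I : Ideal (MvPowerSeries (Fin n) k)}
    (hCM : IsCohenMacaulayLocalOfDim (MvPowerSeries (Fin n) k ⧸ I)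
      ((IsLocalRing.maximalIdeal (MvPowerSeries (Fin n) k)).map (Ideal.Quotient.mk I)) d) :
    HasProjectiveDimensionLT (ModuleCat.of (MvPowerSeries (Fin n) k)
      (MvPowerSeries (Fin n) k ⧸ I)) (n - d + 1) ∧
    ∀ i < n - d, Subsingleton (Abelian.Ext (ModuleCat.of (MvPowerSeries (Fin n) k)
      (MvPowerSeries (Fin n) k ⧸ I)) (ModuleCat.of _ (MvPowerSeries (Fin n) k)) i) := by
  set R := MvPowerSeries (Fin n) k
  set 𝔪 := IsLocalRing.maximalIdeal R
  obtain ⟨hdim, rs, hlen, hmem, hreg⟩ := hCM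
  obtain ⟨rs', rfl, hmem'⟩ := List.exists_map_eq_of_forall_mem (Ideal.Quotient.mk I) (𝔪 : Set R) rs
    fun x hx => by
      simpa using (Ideal.mem_map_iff_of_surjective _ Ideal.Quotient.mk_surjective).1 (hmem x hx)
  rw [List.length_map] at hlen
  have hwr : IsWeaklyRegular (R ⧸ I) rs' :=
    (isWeaklyRegular_map_algebraMap_iff (R ⧸ I) (R ⧸ I) rs').1 hreg.1
  have hnt : Nontrivial (R ⧸ I) := by
    rw [← Module.supportDim_ne_bot_iff_nontrivial R, Module.supportDim_quotient_eq_ringKrullDim,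
      hdim]
    simp
  have hreg' : IsRegular (R ⧸ I) rs' :=
    IsRegular.of_isWeaklyRegular_of_mem_maximalIdeal _ hmem' hwr
  have hsup := Module.supportDim_add_length_eq_supportDim_of_isRegular rs' hreg'
  rw [Module.supportDim_quotient_eq_ringKrullDim, hdim, hlen] at hsup
  have hsup0 : Module.supportDim R ((R ⧸ I) ⧸ (Ideal.ofList rs' • ⊤ : Submodule R (R ⧸ I))) = 0 := by
    have h : Module.supportDim R ((R ⧸ I) ⧸ (Ideal.ofList rs' • ⊤ : Submodule R (R ⧸ I))) + (d : ℕ)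
      = (0 : WithBot ℕ∞) + (d : ℕ) := by rw [zero_add]; exact hsup
    exact le_antisymm ((ENat.WithBot.add_le_add_natCast_right_iff).1 h.le)
      ((ENat.WithBot.add_le_add_natCast_right_iff).1 h.ge)
  have hsupp := (support_of_supportDim_eq_zero _ _ hsup0).subset
  have hpd := hasProjectiveDimensionLT_of_support hsupp
  constructor
  · have h1 := (projectiveDimension_le_iff _ n).2 hpd
    rw [ModuleCat.projectiveDimension_quotient_eq_add_length_of_isWeaklyRegular
      (ModuleCat.of R (R ⧸ I)) rs' hwr hmem', hlen] at h1
    have h0 : (0 : WithBot ℕ∞) ≤ projectiveDimension (ModuleCat.of R (R ⧸ I)) := by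
      have h3 : projectiveDimension (ModuleCat.of R (R ⧸ I)) ≠ ⊥ := by
        rw [Ne, projectiveDimension_eq_bot_iff, ModuleCat.isZero_iff_subsingleton]
        exact not_subsingleton (R ⧸ I)
      obtain ⟨a, ha⟩ := WithBot.ne_bot_iff_exists.1 h3
      rw [← ha]
      exact WithBot.coe_le_coe.2 bot_le
    have hdn : d ≤ n := by
      have h2 : ((d : ℕ) : WithBot ℕ∞) ≤ (n : ℕ) := by
        refine le_trans ?_ h1
        have := add_le_add_left h0 ((d : ℕ) : WithBot ℕ∞)
        simpa [add_comm] using this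
      exact_mod_cast h2
    refine (projectiveDimension_le_iff _ (n - d)).1 ?_
    refine (ENat.WithBot.add_le_add_natCast_right_iff (c := d)).1 (h1.trans ?_)
    rw [← Nat.cast_add, Nat.sub_add_cancel hdn]
  · intro i hi
    refine ModuleCat.subsingleton_ext_of_isWeaklyRegular _ n rs' _ hmem' hwr (fun i hi => ?_) i
      (by omega)
    refine ModuleCat.subsingleton_ext_of_exists_isRegular 𝔪 _ hsupp _ ?_ _ ?_
      isRegular_X i (by simpa using hi)
    · change 𝔪 • (⊤ : Ideal R) < ⊤
      rw [smul_eq_mul, Ideal.mul_top]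
      exact lt_top_iff_ne_top.2 (IsLocalRing.maximalIdeal.isMaximal R).ne_top
    · intro r hr
      obtain ⟨i, rfl⟩ := (List.mem_ofFn' _ _).1 hr
      exact X_mem_maximalIdeal i

end MvPowerSeries

end

section

open Matrix CategoryTheory

namespace MatComplex

variable {R : Type} [CommRing R]

theorem exists_matrix_range [IsNoetherianRing R] [StrongRankCondition R] {a : ℕ} (K : Submodule R (Fin a → R)) :
    ∃ (b : ℕ) (N : Matrix (Fin a) (Fin b) R), LinearMap.range N.mulVecLin = K ∧
      (Module.Free R K → LinearMap.ker N.mulVecLin = ⊥) := by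
  by_cases hK : Module.Free R K
  · let v := Module.finBasis R K
    refine ⟨_, LinearMap.toMatrix' (K.subtype ∘ₗ v.equivFun.symm.toLinearMap), ?_, fun _ => ?_⟩
    · rw [← Matrix.toLin'_apply', Matrix.toLin'_toMatrix', LinearMap.range_comp,
        LinearEquiv.range, Submodule.map_top, Submodule.range_subtype]
    · rw [← Matrix.toLin'_apply', Matrix.toLin'_toMatrix', LinearMap.ker_eq_bot]
      exact Subtype.val_injective.comp v.equivFun.symm.injective
  · obtain ⟨b, f, hf⟩ := Module.Finite.exists_fin' R K
    refine ⟨b, LinearMap.toMatrix' (K.subtype ∘ₗ f), ?_, fun h => absurd h hK⟩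
    rw [← Matrix.toLin'_apply', Matrix.toLin'_toMatrix', LinearMap.range_comp,
      LinearMap.range_eq_top.2 hf, Submodule.map_top, Submodule.range_subtype]

/-- The syzygies of the module presented by a matrix complex. -/
def syz (P : MatComplex R) (I : Ideal R) : ∀ i, Submodule R (Fin (P.rk i) → R)
  | 0 => LinearMap.ker (I.mkQ ∘ₗ Fintype.linearCombination R P.aug)
  | i + 1 => LinearMap.ker (P.d i).mulVecLin

theorem exists_matComplex [IsNoetherianRing R] [StrongRankCondition R] (I : Ideal R) :
    ∃ P : MatComplex R, P.rk 0 = 1 ∧ (∀ j, P.aug j = 1) ∧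
      ∀ i, LinearMap.range (P.d i).mulVecLin = P.syz I i ∧
        (Module.Free R (P.syz I i) → LinearMap.ker (P.d i).mulVecLin = ⊥) := by
  choose b N hN using fun s : Σ a : ℕ, Submodule R (Fin a → R) => exists_matrix_range s.2
  let next : (Σ a : ℕ, Submodule R (Fin a → R)) → Σ a : ℕ, Submodule R (Fin a → R) :=
    fun s => ⟨b s, LinearMap.ker (N s).mulVecLin⟩
  let seq : ℕ → Σ a : ℕ, Submodule R (Fin a → R) := fun i => Nat.rec
    ⟨1, LinearMap.ker (I.mkQ ∘ₗ Fintype.linearCombination R (fun _ : Fin 1 => (1 : R)))⟩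
    (fun _ s => next s) i
  let P : MatComplex R :=
    { rk := fun i => (seq i).1
      d := fun i => N (seq i)
      aug := fun _ => 1 }
  have hP : ∀ i, P.syz I i = (seq i).2 := fun i => by
    cases i <;> rfl
  refine ⟨P, rfl, fun _ => rfl, fun i => ?_⟩
  rw [hP]
  exact hN (seq i)

end MatComplex

namespace ModuleCat

variable {R : Type} [CommRing R] {F M : Type} [AddCommGroup F] [Module R F] [AddCommGroup M]
  [Module R M]

theorem exists_extend_ker {π : F →ₗ[R] M} (hπ : Function.Surjective π)
    {K : Submodule R F} (hK : LinearMap.ker π = K) (Y : Type) [AddCommGroup Y] [Module R Y]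
    (h : Subsingleton (Abelian.Ext (ModuleCat.of R M) (ModuleCat.of R Y) 1)) (f : K →ₗ[R] Y) :
    ∃ g : F →ₗ[R] Y, ∀ x : K, g x = f x := by
  subst hK
  have hS := LinearMap.shortExact_shortComplexKer hπ
  obtain ⟨y, hy⟩ := Abelian.Ext.contravariant_sequence_exact₁ hS (ModuleCat.of R Y)
    (Abelian.Ext.mk₀ (ModuleCat.ofHom f)) (show 1 + 0 = 1 from rfl) (h.elim _ _)
  obtain ⟨g, rfl⟩ := (Abelian.Ext.mk₀_bijective _ _).2 y
  rw [Abelian.Ext.mk₀_comp_mk₀] at hy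
  have := (Abelian.Ext.mk₀_bijective _ _).1 hy
  exact ⟨g.hom, fun x => congrArg (fun t => t.hom x) this⟩

variable [Module.Free R F]

theorem hasProjectiveDimensionLT_ker {π : F →ₗ[R] M} (hπ : Function.Surjective π)
    {K : Submodule R F} (hK : LinearMap.ker π = K) (m : ℕ)
    (h : HasProjectiveDimensionLT (ModuleCat.of R M) (m + 2)) :
    HasProjectiveDimensionLT (ModuleCat.of R K) (m + 1) := by
  subst hK
  have hS := LinearMap.shortExact_shortComplexKer hπ
  have hp : Projective (ModuleCat.of R F) := inferInstance
  exact (hS.hasProjectiveDimensionLT_X₃_iff m hp).1 h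

theorem subsingleton_ext_ker {π : F →ₗ[R] M} (hπ : Function.Surjective π)
    {K : Submodule R F} (hK : LinearMap.ker π = K) (Y : ModuleCat.{0} R) (m : ℕ)
    (h : Subsingleton (Abelian.Ext (ModuleCat.of R M) Y (m + 2))) :
    Subsingleton (Abelian.Ext (ModuleCat.of R K) Y (m + 1)) := by
  subst hK
  have hS := LinearMap.shortExact_shortComplexKer hπ
  have hp : Projective (ModuleCat.of R F) := inferInstance
  have h0 : Subsingleton (Abelian.Ext (ModuleCat.of R F) Y (m + 1)) :=
    Abelian.Ext.subsingleton_of_projective _ Y m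
  have key : ∀ x : Abelian.Ext (ModuleCat.of R (LinearMap.ker π)) Y (m + 1), x = 0 := fun x => by
    obtain ⟨y, hy⟩ := Abelian.Ext.contravariant_sequence_exact₁ hS Y x
      (show 1 + (m + 1) = m + 2 by omega) (h.elim _ _)
    rw [← hy, h0.elim y 0, Abelian.Ext.comp_zero]
  exact ⟨fun x y => (key x).trans (key y).symm⟩

end ModuleCat

end

section

open Matrix CategoryTheory

namespace MatComplex

variable {R : Type} [CommRing R]

/-- The surjection from a term of a matrix complex onto the corresponding syzygy. -/
def toSyz (P : MatComplex R) {I : Ideal R}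
    (hP : ∀ i, LinearMap.range (P.d i).mulVecLin = P.syz I i) (i : ℕ) :
    (Fin (P.rk (i + 1)) → R) →ₗ[R] P.syz I i :=
  (P.d i).mulVecLin.codRestrict (P.syz I i) fun x => hP i ▸ LinearMap.mem_range_self _ x

theorem toSyz_surjective (P : MatComplex R) {I : Ideal R}
    (hP : ∀ i, LinearMap.range (P.d i).mulVecLin = P.syz I i) (i : ℕ) :
    Function.Surjective (P.toSyz hP i) := by
  rintro ⟨x, hx⟩
  rw [← hP i] at hx
  obtain ⟨y, hy⟩ := hx
  exact ⟨y, Subtype.ext hy⟩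

theorem ker_toSyz (P : MatComplex R) {I : Ideal R}
    (hP : ∀ i, LinearMap.range (P.d i).mulVecLin = P.syz I i) (i : ℕ) :
    LinearMap.ker (P.toSyz hP i) = P.syz I (i + 1) :=
  LinearMap.ker_codRestrict _ _ _

theorem _root_.LinearMap.exists_comp_eq_of_ker_le {F M Y : Type} [AddCommGroup F] [Module R F]
    [AddCommGroup M] [Module R M] [AddCommGroup Y] [Module R Y] {π : F →ₗ[R] M}
    (hπ : Function.Surjective π) {f : F →ₗ[R] Y} (hf : LinearMap.ker π ≤ LinearMap.ker f) :
    ∃ g : M →ₗ[R] Y, ∀ x, g (π x) = f x := by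
  refine ⟨(LinearMap.ker π).liftQ f hf ∘ₗ (π.quotKerEquivOfSurjective hπ).symm.toLinearMap,
    fun x => ?_⟩
  have : (π.quotKerEquivOfSurjective hπ).symm (π x) = Submodule.Quotient.mk x := by
    rw [LinearEquiv.symm_apply_eq]
    rfl
  simp [this]

theorem exists_isRes [IsNoetherianRing R] [IsLocalRing R] {I : Ideal R} {h : ℕ} (hI : I ≠ ⊤)
    (hpd : HasProjectiveDimensionLT (ModuleCat.of R (R ⧸ I)) (h + 1))
    (hext : ∀ i < h, Subsingleton (Abelian.Ext (ModuleCat.of R (R ⧸ I)) (ModuleCat.of R R) i)) :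
    ∃ P : MatComplex R, P.IsRes I h := by
  obtain ⟨P, hrk, haug, hP'⟩ := exists_matComplex I
  have hP := fun i => (hP' i).1
  have hinj := fun i => (hP' i).2
  have hmem0 : ∀ x, x ∈ P.syz I 0 ↔ P.aug ⬝ᵥ x ∈ I := fun x => by
    rw [syz, LinearMap.mem_ker, LinearMap.comp_apply, Submodule.mkQ_apply,
      Submodule.Quotient.mk_eq_zero, Fintype.linearCombination_apply, dotProduct]
    simp [mul_comm]
  have hex : ∀ i x, P.d i *ᵥ x = 0 ↔ ∃ y, P.d (i + 1) *ᵥ y = x := fun i x => by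
    have : x ∈ P.syz I (i + 1) ↔ P.d i *ᵥ x = 0 := LinearMap.mem_ker
    rw [← this, ← hP (i + 1)]
    rfl
  let π₀ : (Fin (P.rk 0) → R) →ₗ[R] R ⧸ I := I.mkQ ∘ₗ Fintype.linearCombination R P.aug
  have hsurj : ∃ x, P.aug ⬝ᵥ x = 1 := by
    refine ⟨Pi.single ⟨0, by omega⟩ 1, ?_⟩
    rw [dotProduct_single_one, haug]
  have hπ₀ : Function.Surjective π₀ := by
    refine (Submodule.mkQ_surjective _).comp fun r => ?_
    obtain ⟨x, hx⟩ := hsurj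
    refine ⟨r • x, ?_⟩
    rw [map_smul, Fintype.linearCombination_apply]
    have : ∑ i, x i • P.aug i = 1 := by
      rw [← hx, dotProduct]; simp [mul_comm]
    rw [this, smul_eq_mul, mul_one]
  have hpdZ : ∀ i j, i + j + 1 = h → HasProjectiveDimensionLT (ModuleCat.of R (P.syz I i)) (j + 1) := by
    intro i
    induction i with
    | zero =>
      rintro j rfl
      exact ModuleCat.hasProjectiveDimensionLT_ker hπ₀ rfl j (by convert hpd using 1; omega)
    | succ i ih =>
      intro j hj
      exact ModuleCat.hasProjectiveDimensionLT_ker (P.toSyz_surjective hP i) (P.ker_toSyz hP i) j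
        (ih (j + 1) (by omega))
  have hextZ : ∀ i m, i + m + 2 < h →
      Subsingleton (Abelian.Ext (ModuleCat.of R (P.syz I i)) (ModuleCat.of R R) (m + 1)) := by
    intro i
    induction i with
    | zero =>
      intro m hm
      exact ModuleCat.subsingleton_ext_ker hπ₀ rfl _ m (hext _ (by omega))
    | succ i ih =>
      intro m hm
      exact ModuleCat.subsingleton_ext_ker (P.toSyz_surjective hP i) (P.ker_toSyz hP i) _ m
        (ih (m + 1) (by omega))
  have htop : P.syz I h = ⊥ := by
    cases h with
    | zero =>
      have hp : Projective (ModuleCat.of R (R ⧸ I)) :=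
        projective_iff_hasProjectiveDimensionLT_one.2 hpd
      have := (IsProjective.iff_projective (R := R) (R ⧸ I)).2 hp
      have : Module.Free R (R ⧸ I) := Module.free_of_flat_of_isLocalRing
      have : Nontrivial (R ⧸ I) := Ideal.Quotient.nontrivial_iff.2 hI
      have hI0 : I = ⊥ := by
        rw [← Ideal.annihilator_quotient (I := I)]
        exact Module.annihilator_eq_bot.2 inferInstance
      rw [eq_bot_iff]
      intro x hx
      rw [hmem0, hI0, Submodule.mem_bot] at hx
      have hx' : ∑ i, x i = 0 := by simpa [dotProduct, haug] using hx
      rw [Submodule.mem_bot]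
      ext i
      have : Subsingleton (Fin (P.rk 0)) := by rw [hrk]; infer_instance
      have hu : Finset.univ = {i} := by
        ext j; simp [Subsingleton.elim j i]
      simpa [hu] using hx'
    | succ h =>
      have hp : Projective (ModuleCat.of R (P.syz I h)) :=
        projective_iff_hasProjectiveDimensionLT_one.2 (hpdZ h 0 rfl)
      have := (IsProjective.iff_projective (R := R) (P.syz I h)).2 hp
      have : Module.Free R (P.syz I h) := Module.free_of_flat_of_isLocalRing
      exact hinj h this
  have hzero : ∀ i, P.syz I (h + i) = ⊥ ∧ P.rk (h + i + 1) = 0 := by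
    intro i
    have step : ∀ j, P.syz I j = ⊥ → P.syz I (j + 1) = ⊥ ∧ P.rk (j + 1) = 0 := by
      intro j hj
      have hfree : Module.Free R (P.syz I j) := by rw [hj]; infer_instance
      have h1 := hinj j hfree
      refine ⟨h1, ?_⟩
      by_contra hne
      have hx : (fun _ : Fin (P.rk (j + 1)) => (1 : R)) ∈ LinearMap.ker (P.d j).mulVecLin := by
        rw [LinearMap.mem_ker, LinearMap.range_eq_bot.1 ((hP j).trans hj), LinearMap.zero_apply]
      rw [h1, Submodule.mem_bot] at hx
      exact one_ne_zero (congrFun hx ⟨0, by omega⟩)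
    induction i with
    | zero => exact ⟨htop, (step _ htop).2⟩
    | succ i ih =>
      have := (step _ ih.1).1
      exact ⟨this, (step _ this).2⟩
  refine ⟨P, ⟨fun x => ?_, ?_, hex, fun i hi => ?_, fun i hi z hz => ?_⟩⟩
  · rw [← hmem0, ← hP 0]; rfl
  · obtain ⟨x, hx⟩ := hsurj
    exact ⟨x, by rw [hx, sub_self]; exact I.zero_mem⟩
  · obtain ⟨j, rfl⟩ := Nat.exists_eq_add_of_lt hi
    exact (hzero j).2
  · have hzZ : ∀ x ∈ P.syz I i, z ⬝ᵥ x = 0 := by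
      intro x hx
      rw [← hP i] at hx
      obtain ⟨y, rfl⟩ := hx
      rw [Matrix.mulVecLin_apply, Matrix.dotProduct_mulVec, hz, zero_dotProduct]
    let f : (Fin (P.rk i) → R) →ₗ[R] R := Fintype.linearCombination R z
    have hf : ∀ x, f x = z ⬝ᵥ x := fun x => by
      simp [f, Fintype.linearCombination_apply, dotProduct, mul_comm]
    have hfZ : P.syz I i ≤ LinearMap.ker f := fun x hx => by
      rw [LinearMap.mem_ker, hf, hzZ x hx]
    cases i with
    | zero =>
      obtain ⟨g, hg⟩ := LinearMap.exists_comp_eq_of_ker_le hπ₀ hfZ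
      have hs := hext 0 hi
      have hs' : Subsingleton ((R ⧸ I) →ₗ[R] R) :=
        ((Abelian.Ext.addEquiv₀ (X := ModuleCat.of R (R ⧸ I)) (Y := ModuleCat.of R R)).trans
          ModuleCat.homAddEquiv).symm.subsingleton
      refine (Submodule.mem_bot R).2 (funext fun j => ?_)
      have := hg (Pi.single j 1)
      rw [hs'.elim g 0, hf, dotProduct_single_one] at this
      exact this.symm
    | succ i =>
      obtain ⟨g, hg⟩ := LinearMap.exists_comp_eq_of_ker_le (P.toSyz_surjective hP i)
        ((P.ker_toSyz hP i).trans_le hfZ)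
      obtain ⟨w, hw⟩ : ∃ w : (Fin (P.rk i) → R) →ₗ[R] R, ∀ x : P.syz I i, w x = g x := by
        cases i with
        | zero => exact ModuleCat.exists_extend_ker hπ₀ rfl R (hext 1 hi) g
        | succ i =>
          exact ModuleCat.exists_extend_ker (P.toSyz_surjective hP i) (P.ker_toSyz hP i) R
            (hextZ i 0 hi) g
      refine ⟨fun j => w (Pi.single j 1), ?_⟩
      have hwd : ∀ x, w x = (fun j => w (Pi.single j 1)) ⬝ᵥ x := fun x => by
        rw [LinearMap.pi_apply_eq_sum_univ w x, dotProduct]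
        refine Finset.sum_congr rfl fun j _ => ?_
        rw [smul_eq_mul, mul_comm]
        congr 2
        ext k
        simp [Pi.single_apply, eq_comm]
      ext j
      have h1 := hg (Pi.single j 1)
      rw [← hw, hf, dotProduct_single_one, hwd] at h1
      rw [← h1]
      change ((fun j => w (Pi.single j 1)) ᵥ* P.d i) j = _ ⬝ᵥ (P.d i *ᵥ Pi.single j 1)
      rw [dotProduct_mulVec, dotProduct_single_one]

end MatComplex

end

section

open CategoryTheory Limits

namespace HomologicalComplex

variable {V : Type*} [Category* V] [Abelian V]

/-- The embedding of top homology. -/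
noncomputable def homologyToX (K : ChainComplex V ℕ) (h : ℕ) (hd : K.d (h + 1) h = 0) :
    K.homology h ⟶ K.X h :=
  have := K.isIso_homologyπ (h + 1) h (by simp) hd
  inv (K.homologyπ h) ≫ K.iCycles h

theorem homologyToX_comp (K : ChainComplex V ℕ) (h : ℕ) (hd : K.d (h + 1) h = 0) (j : ℕ) :
    homologyToX K h hd ≫ K.d h j = 0 := by
  simp [homologyToX]

instance mono_homologyToX (K : ChainComplex V ℕ) (h : ℕ) (hd : K.d (h + 1) h = 0) :
    Mono (homologyToX K h hd) := by
  have := K.isIso_homologyπ (h + 1) h (by simp) hd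
  unfold homologyToX
  infer_instance

theorem exact_homologyToX (K : ChainComplex V ℕ) (h : ℕ) (hd : K.d (h + 1) h = 0) (j : ℕ)
    (hj : (ComplexShape.down ℕ).next h = j) :
    (ShortComplex.mk _ _ (homologyToX_comp K h hd j)).Exact := by
  have := K.isIso_homologyπ (h + 1) h (by simp) hd
  refine ShortComplex.exact_of_f_is_kernel _ ?_
  exact IsLimit.ofIsoLimit (K.cyclesIsKernel h j hj)
    (Fork.ext (asIso (K.homologyπ h)) (by simp [homologyToX]))

theorem homologyMap_homologyToX {K L : ChainComplex V ℕ} (φ : K ⟶ L) (h : ℕ)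
    (hK : K.d (h + 1) h = 0) (hL : L.d (h + 1) h = 0) :
    homologyMap φ h ≫ homologyToX L h hL = homologyToX K h hK ≫ φ.f h := by
  have := K.isIso_homologyπ (h + 1) h (by simp) hK
  have := L.isIso_homologyπ (h + 1) h (by simp) hL
  simp [homologyToX, ← cancel_epi (K.homologyπ h)]

end HomologicalComplex

namespace CategoryTheory.ProjectiveResolution

open HomologicalComplex

variable {R : Type} [CommRing R] {X X' : ModuleCat.{0} R}

theorem rightOp_d_eq_zero (P : ProjectiveResolution X) (Y : ModuleCat.{0} R) {h : ℕ}
    (hP : P.complex.d (h + 1) h = 0) :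
    (((((linearYoneda R (ModuleCat.{0} R)).obj Y).rightOp).mapHomologicalComplex _).obj
      P.complex).d (h + 1) h = 0 := by
  rw [Functor.mapHomologicalComplex_obj_d, hP]
  exact Functor.map_zero _ _ _

/-- The quotient map onto the top `Ext`. -/
noncomputable def extTop (P : ProjectiveResolution X) (Y : ModuleCat.{0} R) {h : ℕ}
    (hP : P.complex.d (h + 1) h = 0) :
    ModuleCat.of R (P.complex.X h ⟶ Y) ⟶
      ((Ext R (ModuleCat.{0} R) h).obj (Opposite.op X)).obj Y :=
  ((P.isoLeftDerivedObj ((linearYoneda R (ModuleCat.{0} R)).obj Y).rightOp h).hom ≫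
    homologyToX _ h (rightOp_d_eq_zero P Y hP)).unop

theorem extTop_surjective (P : ProjectiveResolution X) (Y : ModuleCat.{0} R) {h : ℕ}
    (hP : P.complex.d (h + 1) h = 0) : Function.Surjective (P.extTop Y hP).hom := by
  refine (ModuleCat.epi_iff_surjective _).1 ?_
  unfold extTop
  have := mono_homologyToX _ h (rightOp_d_eq_zero P Y hP)
  have := @mono_comp _ _ _ _ _
    (P.isoLeftDerivedObj ((linearYoneda R (ModuleCat.{0} R)).obj Y).rightOp h).hom inferInstance
    (homologyToX _ h (rightOp_d_eq_zero P Y hP)) this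
  exact @unop_epi_of_mono _ _ _ _ _ this

theorem extTop_eq_zero_iff (P : ProjectiveResolution X) (Y : ModuleCat.{0} R) {h : ℕ}
    (hP : P.complex.d (h + 1) h = 0) {j : ℕ} (hj : (ComplexShape.down ℕ).next h = j)
    (f : P.complex.X h ⟶ Y) :
    (P.extTop Y hP).hom f = 0 ↔ ∃ g : P.complex.X j ⟶ Y, P.complex.d h j ≫ g = f := by
  have hex := (exact_homologyToX _ h (rightOp_d_eq_zero P Y hP) j hj).unop
  constructor
  · intro hf
    have h0 : (homologyToX _ h (rightOp_d_eq_zero P Y hP)).unop.hom f = 0 := by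
      have := congrArg
        (P.isoLeftDerivedObj ((linearYoneda R (ModuleCat.{0} R)).obj Y).rightOp h).inv.unop.hom hf
      have e : P.extTop Y hP ≫
          (P.isoLeftDerivedObj ((linearYoneda R (ModuleCat.{0} R)).obj Y).rightOp h).inv.unop =
          (homologyToX _ h (rightOp_d_eq_zero P Y hP)).unop := by
        apply Quiver.Hom.op_inj
        exact Iso.inv_hom_id_assoc
          (P.isoLeftDerivedObj ((linearYoneda R (ModuleCat.{0} R)).obj Y).rightOp h)
          (homologyToX _ h (rightOp_d_eq_zero P Y hP))
      exact (congrArg (fun k => k.hom f) e).symm.trans (this.trans (map_zero _))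
    exact (ShortComplex.moduleCat_exact_iff _).1 hex f h0
  · rintro ⟨g, rfl⟩
    have h0 := congrArg (fun k => k.unop.hom g)
      (homologyToX_comp _ h (rightOp_d_eq_zero P Y hP) j)
    have := congrArg
        (P.isoLeftDerivedObj ((linearYoneda R (ModuleCat.{0} R)).obj Y).rightOp h).hom.unop.hom h0
    exact this.trans (map_zero _)

theorem extTop_naturality (P : ProjectiveResolution X) (P' : ProjectiveResolution X')
    (Y : ModuleCat.{0} R) {h : ℕ}
    (hP : P.complex.d (h + 1) h = 0) (hP' : P'.complex.d (h + 1) h = 0)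
    (f : X' ⟶ X) (φ : P'.complex ⟶ P.complex) (comm : φ.f 0 ≫ P.π.f 0 = P'.π.f 0 ≫ f)
    (g : P.complex.X h ⟶ Y) :
    (((Ext R (ModuleCat.{0} R) h).map f.op).app Y).hom ((P.extTop Y hP).hom g) =
      (P'.extTop Y hP').hom (φ.f h ≫ g) := by
  have key : P.extTop Y hP ≫ ((Ext R (ModuleCat.{0} R) h).map f.op).app Y =
      ModuleCat.ofHom (Linear.leftComp R Y (φ.f h)) ≫ P'.extTop Y hP' := by
    apply Quiver.Hom.op_inj
    have h1 := ProjectiveResolution.isoLeftDerivedObj_hom_naturality f P' P φ comm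
      ((linearYoneda R (ModuleCat.{0} R)).obj Y).rightOp h
    have h2 := homologyMap_homologyToX
      ((((linearYoneda R (ModuleCat.{0} R)).obj Y).rightOp.mapHomologicalComplex _).map φ) h
      (rightOp_d_eq_zero P' Y hP') (rightOp_d_eq_zero P Y hP)
    have h3 := (reassoc_of% h1) (homologyToX _ h (rightOp_d_eq_zero P Y hP))
    exact h3.trans ((congrArg _ h2).trans (Category.assoc _ _ _).symm)
  exact congrArg (fun k => k.hom g) key

end CategoryTheory.ProjectiveResolution

end

section

open Matrix CategoryTheory Limits

namespace MatComplex

variable {R : Type} [CommRing R] {P Q : MatComplex R} {I J : Ideal R} {h : ℕ}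

/-- The chain complex of free modules attached to a complex of matrices. -/
noncomputable def IsRes.complex (hP : P.IsRes I h) : ChainComplex (ModuleCat.{0} R) ℕ :=
  ChainComplex.of (fun i => ModuleCat.of R (Fin (P.rk i) → R))
    (fun i => ModuleCat.ofHom (P.d i).mulVecLin) fun i => by
      rw [← ModuleCat.ofHom_comp, ← Matrix.mulVecLin_mul, hP.d_mul_d, Matrix.mulVecLin_zero]
      rfl

theorem IsRes.complex_d (hP : P.IsRes I h) (i : ℕ) :
    hP.complex.d (i + 1) i = ModuleCat.ofHom (P.d i).mulVecLin :=
  ChainComplex.of_d (fun i => ModuleCat.of R (Fin (P.rk i) → R))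
    (fun i => ModuleCat.ofHom (P.d i).mulVecLin) i

/-- The augmentation map. -/
noncomputable def augMap (P : MatComplex R) (I : Ideal R) : (Fin (P.rk 0) → R) →ₗ[R] R ⧸ I :=
  Submodule.mkQ I ∘ₗ Fintype.linearCombination R P.aug

theorem augMap_apply (P : MatComplex R) (I : Ideal R) (x : Fin (P.rk 0) → R) :
    P.augMap I x = Ideal.Quotient.mk I (P.aug ⬝ᵥ x) := by
  simp only [augMap, LinearMap.comp_apply, Fintype.linearCombination_apply, dotProduct,
    smul_eq_mul, mul_comm]
  rfl

theorem IsRes.augMap_surjective (hP : P.IsRes I h) : Function.Surjective (P.augMap I) := by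
  intro y
  obtain ⟨r, rfl⟩ := Ideal.Quotient.mk_surjective y
  obtain ⟨x, hx⟩ := hP.aug_surj
  refine ⟨r • x, ?_⟩
  rw [augMap_apply, Ideal.Quotient.eq, dotProduct_smul, smul_eq_mul]
  convert I.mul_mem_left r hx using 1
  ring

/-- The augmentation as a morphism. -/
noncomputable def IsRes.augHom (hP : P.IsRes I h) : hP.complex.X 0 ⟶ ModuleCat.of R (R ⧸ I) :=
  ModuleCat.ofHom (P.augMap I)

theorem IsRes.augHom_apply (hP : P.IsRes I h) (x : Fin (P.rk 0) → R) :
    hP.augHom.hom x = Ideal.Quotient.mk I (P.aug ⬝ᵥ x) :=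
  P.augMap_apply I x

theorem IsRes.complex_d_augHom (hP : P.IsRes I h) : hP.complex.d 1 0 ≫ hP.augHom = 0 := by
  rw [hP.complex_d 0]
  refine ModuleCat.hom_ext (LinearMap.ext fun x => ?_)
  exact (hP.augHom_apply (P.d 0 *ᵥ x)).trans
    (Ideal.Quotient.eq_zero_iff_mem.2 ((hP.aug_mem _).2 ⟨x, rfl⟩))

/-- The projective resolution attached to a resolution by matrices. -/
noncomputable def IsRes.projectiveResolution (hP : P.IsRes I h) :
    ProjectiveResolution (ModuleCat.of R (R ⧸ I)) where
  complex := hP.complex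
  projective i := by
    exact (IsProjective.iff_projective (R := R) (P := Fin (P.rk i) → R)).1 inferInstance
  π := (ChainComplex.toSingle₀Equiv _ _).symm ⟨hP.augHom, hP.complex_d_augHom⟩
  quasiIso := ⟨fun i => by
    cases i with
    | zero =>
      rw [ChainComplex.quasiIsoAt₀_iff, ShortComplex.quasiIso_iff_of_zeros']
      · refine (ShortComplex.exact_and_epi_g_iff_of_iso
          (S₂ := ShortComplex.mk _ _ hP.complex_d_augHom) ?_).2 ⟨?_, ?_⟩
        · exact ShortComplex.isoMk (Iso.refl _) (Iso.refl _) (Iso.refl _)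
            ((Category.id_comp _).trans (Category.comp_id _).symm)
            ((Category.id_comp _).trans (Eq.trans (by simp; rfl) (Category.comp_id _).symm))
        · rw [ShortComplex.moduleCat_exact_iff]
          intro (x : Fin (P.rk 0) → R) hx
          obtain ⟨y, hy⟩ := (hP.aug_mem x).1
            (Ideal.Quotient.eq_zero_iff_mem.1 ((hP.augHom_apply x).symm.trans hx))
          refine ⟨y, ?_⟩
          change (hP.complex.d 1 0).hom y = x
          rw [hP.complex_d 0]
          exact hy
        · exact (ModuleCat.epi_iff_surjective _).2 hP.augMap_surjective
      all_goals rfl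
    | succ i =>
      rw [quasiIsoAt_iff_exactAt']
      · rw [HomologicalComplex.exactAt_iff' _ (i + 2) (i + 1) i (by simp) (by simp),
          ShortComplex.moduleCat_exact_iff]
        intro x hx
        obtain ⟨y, hy⟩ := (hP.exact i x).1 (by
          have : (hP.complex.d (i + 1) i).hom x = 0 := hx
          rw [hP.complex_d] at this
          exact this)
        refine ⟨y, ?_⟩
        change (hP.complex.d (i + 1 + 1) (i + 1)).hom y = x
        rw [hP.complex_d]
        exact hy
      · apply ChainComplex.exactAt_succ_single_obj⟩

theorem IsRes.complex_d_top (hP : P.IsRes I h) :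
    hP.projectiveResolution.complex.d (h + 1) h = 0 := by
  change hP.complex.d (h + 1) h = 0
  rw [hP.complex_d]
  refine ModuleCat.hom_ext (LinearMap.ext fun x => ?_)
  change P.d h *ᵥ x = 0
  have := hP.isEmpty (Nat.lt_succ_self h)
  rw [Subsingleton.elim (α := Fin (P.rk (h + 1)) → R) x 0, Matrix.mulVec_zero]

/-- Linear forms on `R ^ n` as morphisms. -/
noncomputable def formHom (n : ℕ) :
    (Fin n → R) →ₗ[R] ModuleCat.of R (ModuleCat.of R (Fin n → R) ⟶ ModuleCat.of R R) where
  toFun z := ModuleCat.ofHom (Fintype.linearCombination R z)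
  map_add' x y := by
    ext i
    simp [Fintype.linearCombination_apply, Finset.sum_add_distrib, mul_add]
  map_smul' r x := by
    ext i
    simp [Fintype.linearCombination_apply, Finset.mul_sum, mul_left_comm]

theorem formHom_apply {n : ℕ} (z x : Fin n → R) : (formHom n z).hom x = z ⬝ᵥ x := by
  simp [formHom, Fintype.linearCombination_apply, dotProduct, mul_comm]

theorem formHom_surjective (n : ℕ) : Function.Surjective (formHom (R := R) n) := by
  intro f
  refine ⟨fun j => f.hom (Pi.single j 1), ?_⟩
  ext x
  simp [formHom, Fintype.linearCombination_apply, Pi.single_apply]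

theorem ofHom_mulVecLin_comp {m n : ℕ} (M : Matrix (Fin m) (Fin n) R) (z : Fin m → R) :
    ModuleCat.ofHom M.mulVecLin ≫ formHom m z = formHom n (z ᵥ* M) := by
  refine ModuleCat.hom_ext (LinearMap.ext fun x => ?_)
  refine Eq.trans ?_ (formHom_apply _ _).symm
  refine (formHom_apply z (M *ᵥ x)).trans ?_
  rw [dotProduct_mulVec]

/-- The map from top-degree forms onto `Ext`. -/
noncomputable def IsRes.toExt (hP : P.IsRes I h) :
    (Fin (P.rk h) → R) →ₗ[R] extModule R h (R ⧸ I) R :=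
  (hP.projectiveResolution.extTop (ModuleCat.of R R) hP.complex_d_top).hom ∘ₗ formHom (P.rk h)

theorem IsRes.toExt_surjective (hP : P.IsRes I h) : Function.Surjective hP.toExt :=
  (hP.projectiveResolution.extTop_surjective _ hP.complex_d_top).comp (formHom_surjective _)

theorem IsRes.toExt_eq_zero_iff (hP : P.IsRes I h) (z : Fin (P.rk h) → R) :
    hP.toExt z = 0 ↔ z ∈ P.cobd h := by
  have key : ∀ {j : ℕ} (hj : (ComplexShape.down ℕ).next h = j), hP.toExt z = 0 ↔
      ∃ g : hP.complex.X j ⟶ ModuleCat.of R R, hP.complex.d h j ≫ g = formHom (P.rk h) z :=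
    fun hj => hP.projectiveResolution.extTop_eq_zero_iff _ hP.complex_d_top hj _
  have hinj : ∀ {n : ℕ} {z w : Fin n → R}, formHom n z = formHom n w → z = w := by
    intro n z w hzw
    ext j
    have : (formHom n z).hom (Pi.single j 1) = (formHom n w).hom (Pi.single j 1) :=
      congrArg (fun f => f.hom (Pi.single j 1)) hzw
    rwa [formHom_apply, formHom_apply, dotProduct_single_one, dotProduct_single_one] at this
  cases h with
  | zero =>
    rw [key (j := 0) (by simp)]
    constructor
    · rintro ⟨g, hg⟩
      rw [HomologicalComplex.shape _ _ _ (by simp), zero_comp] at hg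
      exact (Submodule.mem_bot R).2 (hinj (hg.symm.trans (map_zero (formHom (P.rk 0))).symm))
    · intro hz
      rw [(Submodule.mem_bot R).1 hz]
      exact ⟨0, by rw [map_zero]; exact comp_zero⟩
  | succ h =>
    rw [key (j := h) (by simp)]
    rw [hP.complex_d]
    constructor
    · rintro ⟨g, hg⟩
      obtain ⟨w, rfl⟩ := formHom_surjective (P.rk h) g
      exact ⟨w, hinj ((ofHom_mulVecLin_comp _ _).symm.trans hg)⟩
    · rintro ⟨w, rfl⟩
      exact ⟨formHom _ w, ofHom_mulVecLin_comp _ _⟩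

/-- The morphism of chain complexes attached to a chain map. -/
noncomputable def IsChainMap.hom (hP : P.IsRes I h) (hQ : Q.IsRes J h) {g}
    (hg : IsChainMap Q P g) : hQ.complex ⟶ hP.complex :=
  ChainComplex.ofHom (X := hQ.complex) (Y := hP.complex)
    (fun i => ModuleCat.ofHom (g i).mulVecLin) fun i => by
      rw [hP.complex_d, hQ.complex_d]
      refine ModuleCat.hom_ext (LinearMap.ext fun x : Fin (Q.rk (i + 1)) → R => ?_)
      change P.d i *ᵥ (g (i + 1) *ᵥ x) = g i *ᵥ (Q.d i *ᵥ x)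
      rw [Matrix.mulVec_mulVec, Matrix.mulVec_mulVec, hg i]

theorem IsRes.toExt_naturality (hP : P.IsRes I h) (hQ : Q.IsRes J h) (hJI : J ≤ I) {g}
    (hg : IsChainMap Q P g) (hg0 : ∀ x, P.aug ⬝ᵥ (g 0 *ᵥ x) - Q.aug ⬝ᵥ x ∈ I)
    (z : Fin (P.rk h) → R) :
    (((Ext R (ModuleCat.{0} R) h).map (ModuleCat.ofHom (Submodule.mapQ J I LinearMap.id hJI)).op).app
      (ModuleCat.of R R)).hom (hP.toExt z) = hQ.toExt (z ᵥ* g h) := by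
  have comm : (IsChainMap.hom hP hQ hg).f 0 ≫ hP.projectiveResolution.π.f 0 =
      hQ.projectiveResolution.π.f 0 ≫
        ModuleCat.ofHom (Submodule.mapQ J I LinearMap.id hJI) := by
    have e1 : hP.projectiveResolution.π.f 0 = hP.augHom :=
      ChainComplex.toSingle₀Equiv_symm_apply_f_zero _ _
    have e2 : hQ.projectiveResolution.π.f 0 = hQ.augHom :=
      ChainComplex.toSingle₀Equiv_symm_apply_f_zero _ _
    rw [e1, e2]
    refine ModuleCat.hom_ext (LinearMap.ext fun x => ?_)
    change hP.augHom.hom (g 0 *ᵥ x) = Submodule.mapQ J I LinearMap.id hJI (hQ.augHom.hom x)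
    refine (hP.augHom_apply (g 0 *ᵥ x)).trans (Eq.trans ?_
      (congrArg (Submodule.mapQ J I LinearMap.id hJI) (hQ.augHom_apply x)).symm)
    exact (Ideal.Quotient.eq).2 (hg0 x)
  refine (ProjectiveResolution.extTop_naturality hP.projectiveResolution hQ.projectiveResolution
    (ModuleCat.of R R) hP.complex_d_top hQ.complex_d_top _ (IsChainMap.hom hP hQ hg) comm
    (formHom _ z)).trans ?_
  exact congrArg _ (ofHom_mulVecLin_comp (g h) z)

end MatComplex

end

section

open CategoryTheory Limits Opposite

namespace localCohomology

variable {R : Type} [CommRing R] {J : Ideal R}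

/-- A decreasing sequence of ideals as a functor. -/
def antitoneDiagram (K : ℕ → Ideal R) (hK : Antitone K) : ℕᵒᵖ ⥤ Ideal R where
  obj t := K (unop t)
  map w := ⟨⟨hK w.unop.down.down⟩⟩

/-- A decreasing sequence of ideals as a functor to the ideals whose radical contains `J`. -/
def antitoneToSelfLERadical (K : ℕ → Ideal R) (hK : Antitone K) (hJ : ∀ e, J ≤ (K e).radical) :
    ℕᵒᵖ ⥤ SelfLERadical J :=
  ObjectProperty.lift _ (antitoneDiagram K hK) fun e => hJ (unop e)

theorem antitone_initial [IsNoetherianRing R] (K : ℕ → Ideal R) (hK : Antitone K)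
    (hJ : ∀ e, J ≤ (K e).radical) (hcof : ∀ t, ∃ e, K e ≤ J ^ t) :
    (antitoneToSelfLERadical K hK hJ).Initial where
  out J' := by
    apply +allowSynthFailures zigzag_isConnected
    · obtain ⟨t, ht⟩ := Ideal.exists_pow_le_of_le_radical_of_fg J'.2
        (isNoetherian_def.mp inferInstance _)
      obtain ⟨e, he⟩ := hcof t
      exact ⟨CostructuredArrow.mk
        (⟨⟨⟨he.trans ht⟩⟩⟩ : (antitoneToSelfLERadical K hK hJ).obj (op e) ⟶ J')⟩
    · intro j1 j2
      apply Relation.ReflTransGen.single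
      rcases le_total (unop j1.left) (unop j2.left) with h | h
      · right; exact ⟨CostructuredArrow.homMk (homOfLE h).op rfl⟩
      · left; exact ⟨CostructuredArrow.homMk (homOfLE h).op rfl⟩

/-- Local cohomology computed by a cofinal decreasing sequence of ideals. -/
noncomputable def isoOfAntitone [IsNoetherianRing R] (K : ℕ → Ideal R) (hK : Antitone K)
    (hJ : ∀ e, J ≤ (K e).radical) (hcof : ∀ t, ∃ e, K e ≤ J ^ t) (i : ℕ) :
    localCohomology J i ≅ ofDiagram (antitoneDiagram K hK) i :=
  have := antitone_initial K hK hJ hcof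
  (isoSelfLERadical J i).symm ≪≫
    (isoOfFinal.{0, 0, 0} (antitoneToSelfLERadical K hK hJ) (selfLERadicalDiagram J) i).symm ≪≫
      HasColimit.isoOfNatIso (Iso.refl _)

/-- The transition maps of the system of `Ext` modules. -/
noncomputable def extTransition (K : ℕ → Ideal R) (hK : Antitone K) (i : ℕ) (M : ModuleCat.{0} R)
    (e : ℕ) : ((Ext R (ModuleCat.{0} R) i).obj (op (ModuleCat.of R (R ⧸ K e)))).obj M ⟶
      ((Ext R (ModuleCat.{0} R) i).obj (op (ModuleCat.of R (R ⧸ K (e + 1))))).obj M :=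
  ((Ext R (ModuleCat.{0} R) i).map (ModuleCat.ofHom
    (Submodule.mapQ (K (e + 1)) (K e) LinearMap.id (hK e.le_succ))).op).app M

theorem nonempty_directLimit_equiv [IsNoetherianRing R] (K : ℕ → Ideal R) (hK : Antitone K)
    (hJ : ∀ e, J ≤ (K e).radical) (hcof : ∀ t, ∃ e, K e ≤ J ^ t) (i : ℕ) (M : ModuleCat.{0} R)
    (G : ℕ → Type) [∀ e, AddCommGroup (G e)] [∀ e, Module R (G e)]
    (f : ∀ a b, a ≤ b → G a →ₗ[R] G b) [DirectedSystem G fun a b h => f a b h]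
    (θ : ∀ e, ((Ext R (ModuleCat.{0} R) i).obj (op (ModuleCat.of R (R ⧸ K e)))).obj M ≃ₗ[R] G e)
    (hθ : ∀ e x, θ (e + 1) ((extTransition K hK i M e).hom x) =
      f e (e + 1) e.le_succ (θ e x)) :
    Nonempty ((localCohomology J i).obj M ≃ₗ[R] Module.DirectLimit G f) := by
  let D := diagram (antitoneDiagram K hK) i
  let F : ℕ ⥤ ModuleCat.{0} R := opOp ℕ ⋙ D ⋙ (evaluation _ _).obj M
  let τ : F ⟶ ModuleCat.directLimitDiagram G f :=
    NatTrans.ofSequence (fun e => ModuleCat.ofHom (θ e).toLinearMap) fun e =>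
      ModuleCat.hom_ext (LinearMap.ext fun x => hθ e x)
  have : ∀ e, IsIso (τ.app e) := fun e => (θ e).toModuleIso.isIso_hom
  have : IsIso τ := NatIso.isIso_of_isIso_app τ
  have e1 : (localCohomology J i).obj M ≅ (colimit D).obj M :=
    (isoOfAntitone K hK hJ hcof i).app M
  have e2 : (colimit D).obj M ≅ colimit (D ⋙ (evaluation _ _).obj M) :=
    colimitObjIsoColimitCompEvaluation _ _
  have e3 : colimit F ≅ colimit (D ⋙ (evaluation _ _).obj M) :=
    Functor.Final.colimitIso (opOp ℕ) (D ⋙ (evaluation _ _).obj M)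
  have e4 : colimit F ≅ colimit (ModuleCat.directLimitDiagram G f) :=
    HasColimit.isoOfNatIso (asIso τ)
  have e5 : colimit (ModuleCat.directLimitDiagram G f) ≅
      ModuleCat.of R (Module.DirectLimit G f) :=
    (colimit.isColimit _).coconePointUniqueUpToIso (ModuleCat.directLimitIsColimit G f)
  exact ⟨(e1 ≪≫ e2 ≪≫ e3.symm ≪≫ e4 ≪≫ e5).toLinearEquiv⟩

end localCohomology

end

section

open Matrix

theorem frobPow_pow_eq_map {R : Type} [CommRing R] (p : ℕ) [ExpChar R p] (e : ℕ) (I : Ideal R) :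
    frobPow (p ^ e) I = I.map (iterateFrobenius R p e) := rfl

theorem frobPow_eq_map {R : Type} [CommRing R] (p : ℕ) [ExpChar R p] (I : Ideal R) :
    frobPow p I = I.map (frobenius R p) := rfl

theorem frobPow_pow_succ {R : Type} [CommRing R] (p : ℕ) [ExpChar R p] (e : ℕ) (I : Ideal R) :
    frobPow (p ^ (e + 1)) I = (frobPow p I).map (iterateFrobenius R p e) := by
  rw [frobPow_pow_eq_map p (e + 1), frobPow_eq_map p I, Ideal.map_map]
  congr 1
  ext x
  simp [iterateFrobenius_def, frobenius_def, ← pow_mul, pow_succ']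

theorem pow_mul_mem_frobPow {R : Type} [CommRing R] (p : ℕ) [ExpChar R p] {I : Ideal R} {u : R}
    (hu : u ∈ Submodule.colon (frobPow p I) (I : Set R)) (e : ℕ) (x : R)
    (hx : x ∈ frobPow (p ^ e) I) :
    u ^ p ^ e * x ∈ frobPow (p ^ (e + 1)) I := by
  rw [frobPow_pow_succ]
  refine Submodule.span_induction (p := fun x _ => u ^ p ^ e * x ∈
    (frobPow p I).map (iterateFrobenius R p e)) ?_ (by simp) ?_ ?_ hx
  · rintro _ ⟨x, hx, rfl⟩
    have := Ideal.mem_map_of_mem (iterateFrobenius R p e) (Submodule.mem_colon.1 hu x hx)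
    simpa [iterateFrobenius_def, mul_pow] using this
  · intro x y _ _ hx hy
    rw [mul_add]
    exact Ideal.add_mem _ hx hy
  · intro a x _ hx
    rw [smul_eq_mul, mul_left_comm]
    exact Ideal.mul_mem_left _ _ hx

/-- Multiplication by `v` on subquotients of `R`. -/
def quotMul {R : Type} [CommRing R] {I Ω I' Ω' : Ideal R} (v : R)
    (hΩ : ∀ x ∈ Ω, v * x ∈ Ω') (hI : ∀ x ∈ I, v * x ∈ I') :
    (↥Ω ⧸ Submodule.comap Ω.subtype (I : Submodule R R)) →ₗ[R]
      ↥Ω' ⧸ Submodule.comap Ω'.subtype (I' : Submodule R R) :=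
  Submodule.mapQ _ _ ((LinearMap.mulLeft R v).restrict hΩ) fun x hx => hI x hx

theorem quotMul_mk {R : Type} [CommRing R] {I Ω I' Ω' : Ideal R} (v : R)
    (hΩ : ∀ x ∈ Ω, v * x ∈ Ω') (hI : ∀ x ∈ I, v * x ∈ I') (x : ↥Ω) :
    quotMul v hΩ hI (Submodule.Quotient.mk x) = Submodule.Quotient.mk ⟨v * x, hΩ x x.2⟩ :=
  rfl

theorem prod_pow_mul_mem {R : Type} [CommRing R] {K : ℕ → Ideal R} {v : ℕ → R}
    (hv : ∀ e, ∀ x ∈ K e, v e * x ∈ K (e + 1)) {i j : ℕ} (hij : i ≤ j) (x : R) (hx : x ∈ K i) :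
    (∏ e ∈ Finset.Ico i j, v e) * x ∈ K j := by
  induction j, hij using Nat.le_induction with
  | base => simpa using hx
  | succ j hij ih =>
    rw [Finset.prod_Ico_succ_top hij, mul_comm _ (v j), mul_assoc]
    exact hv j _ ih

theorem LinearMap.exists_equiv_of_ker_eq {R M N N' : Type} [CommRing R] [AddCommGroup M]
    [AddCommGroup N] [AddCommGroup N'] [Module R M] [Module R N] [Module R N'] (f : M →ₗ[R] N)
    (g : M →ₗ[R] N') (hf : Function.Surjective f) (hg : Function.Surjective g)
    (hfg : ∀ x, f x = 0 ↔ g x = 0) : ∃ θ : N ≃ₗ[R] N', ∀ x, θ (f x) = g x := by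
  have hker : f.ker = g.ker := Submodule.ext fun x => by simpa using hfg x
  refine ⟨(f.quotKerEquivOfSurjective hf).symm ≪≫ₗ
    Submodule.quotEquivOfEq _ _ hker ≪≫ₗ g.quotKerEquivOfSurjective hg, fun x => ?_⟩
  have : (f.quotKerEquivOfSurjective hf).symm (f x) = Submodule.Quotient.mk x := by
    rw [LinearEquiv.symm_apply_eq]; rfl
  change g.quotKerEquivOfSurjective hg
    (Submodule.quotEquivOfEq _ _ hker ((f.quotKerEquivOfSurjective hf).symm (f x))) = g x
  rw [this]
  rfl

namespace MatComplex

variable {R : Type} [CommRing R] {P : MatComplex R} {I Ω : Ideal R} {h : ℕ}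

theorem IsPres.dotProduct_mem {c} (hc : P.IsPres I Ω h c) (z : Fin (P.rk h) → R) :
    z ⬝ᵥ c ∈ Ω :=
  MatComplex.dotProduct_mem z c fun j => by
    rw [hc.eq_sup]
    exact Ideal.mem_sup_right (Ideal.subset_span ⟨j, rfl⟩)

/-- The map onto `Ω ⧸ I` given by a presentation. -/
def IsPres.toQuot {c} (hc : P.IsPres I Ω h c) :
    (Fin (P.rk h) → R) →ₗ[R] ↥Ω ⧸ Submodule.comap Ω.subtype (I : Submodule R R) where
  toFun z := Submodule.Quotient.mk ⟨z ⬝ᵥ c, hc.dotProduct_mem z⟩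
  map_add' x y := by
    rw [← Submodule.Quotient.mk_add]
    congr 2
    exact add_dotProduct _ _ _
  map_smul' r x := by
    rw [← Submodule.Quotient.mk_smul]
    congr 2
    exact smul_dotProduct _ _ _

theorem IsPres.toQuot_eq_zero_iff {c} (hc : P.IsPres I Ω h c) (z : Fin (P.rk h) → R) :
    hc.toQuot z = 0 ↔ z ∈ P.cobd h := by
  rw [← hc.mem_iff]
  exact Submodule.Quotient.mk_eq_zero _

theorem IsPres.toQuot_surjective {c} (hc : P.IsPres I Ω h c) : Function.Surjective hc.toQuot := by
  intro x
  obtain ⟨⟨x, hx⟩, rfl⟩ := Submodule.Quotient.mk_surjective _ x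
  obtain ⟨W, hW⟩ := exists_mulVec_sub_mem hc.eq_sup (fun _ : Unit => x) fun _ => hx
  refine ⟨W (), ((Submodule.Quotient.eq _).2 ?_).symm⟩
  exact hW ()

theorem exists_isPres (hP : P.IsRes I h) (hΩ : IsCanonicalIdeal R h I Ω) :
    ∃ c, P.IsPres I Ω h c := by
  obtain ⟨hle, ⟨ψ⟩⟩ := hΩ
  choose c hc using fun j : Fin (P.rk h) =>
    Submodule.Quotient.mk_surjective _ (ψ.symm (hP.toExt (Pi.single j 1)))
  have key : ∀ z : Fin (P.rk h) → R, ψ.symm (hP.toExt z) =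
      Submodule.Quotient.mk (∑ j, z j • c j) := fun z => by
    rw [← Submodule.mkQ_apply, map_sum]
    simp_rw [map_smul, Submodule.mkQ_apply, hc]
    conv_lhs => rw [pi_eq_sum_univ' z]
    simp [map_sum, map_smul]
  have hdot : ∀ z : Fin (P.rk h) → R,
      ((∑ j, z j • c j : ↥Ω) : R) = z ⬝ᵥ fun j => (c j : R) := fun z => by
    simp [dotProduct]
  refine ⟨fun j => c j, ⟨fun z => ?_, le_antisymm (fun x hx => ?_) (sup_le hle ?_)⟩⟩
  · rw [← hP.toExt_eq_zero_iff, ← ψ.symm.map_eq_zero_iff, key, Submodule.Quotient.mk_eq_zero,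
      ← hdot]
    rfl
  · obtain ⟨z, hz⟩ := hP.toExt_surjective (ψ (Submodule.Quotient.mk ⟨x, hx⟩))
    have h1 := key z
    rw [hz, ψ.symm_apply_apply] at h1
    have h2 : x - z ⬝ᵥ (fun j => (c j : R)) ∈ I := by
      rw [← hdot]
      exact (Submodule.Quotient.eq (Submodule.comap Ω.subtype (I : Submodule R R))).1 h1
    rw [← sub_add_cancel x (z ⬝ᵥ fun j => (c j : R))]
    refine Ideal.add_mem _ (Ideal.mem_sup_left h2) (Ideal.mem_sup_right ?_)
    exact MatComplex.dotProduct_mem z _ fun j => Ideal.subset_span ⟨j, rfl⟩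
  · rw [Ideal.span_le]
    rintro _ ⟨j, rfl⟩
    exact (c j).2

end MatComplex

end

section

open Matrix CategoryTheory

/-- The direct system of the `quotFrob R p Ω I e` given by multiplication by powers of `u`. -/
def quotFrobMap {R : Type} [CommRing R] {p : ℕ} {Ω I : Ideal R} {u : R}
    (hΩ : ∀ e : ℕ, ∀ x ∈ frobPow (p ^ e) Ω, u ^ p ^ e * x ∈ frobPow (p ^ (e + 1)) Ω)
    (hI : ∀ e : ℕ, ∀ x ∈ frobPow (p ^ e) I, u ^ p ^ e * x ∈ frobPow (p ^ (e + 1)) I)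
    (i j : ℕ) (h : i ≤ j) : quotFrob R p Ω I i →ₗ[R] quotFrob R p Ω I j :=
  quotMul (∏ e ∈ Finset.Ico i j, u ^ p ^ e)
    (prod_pow_mul_mem (K := fun e => frobPow (p ^ e) Ω) hΩ h)
    (prod_pow_mul_mem (K := fun e => frobPow (p ^ e) I) hI h)

section quotFrobMap

variable {R : Type} [CommRing R] {p : ℕ} {Ω I : Ideal R} {u : R}
  (hΩ : ∀ e : ℕ, ∀ x ∈ frobPow (p ^ e) Ω, u ^ p ^ e * x ∈ frobPow (p ^ (e + 1)) Ω)
  (hI : ∀ e : ℕ, ∀ x ∈ frobPow (p ^ e) I, u ^ p ^ e * x ∈ frobPow (p ^ (e + 1)) I)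

theorem directedSystem_quotFrobMap :
    DirectedSystem (quotFrob R p Ω I) (fun i j h => quotFrobMap hΩ hI i j h) where
  map_self i x := by
    obtain ⟨x, rfl⟩ := Submodule.Quotient.mk_surjective _ x
    change Submodule.Quotient.mk _ = _
    congr 1
    ext
    simp
  map_map l j i hij hjl x := by
    obtain ⟨x, rfl⟩ := Submodule.Quotient.mk_surjective _ x
    change Submodule.Quotient.mk _ = Submodule.Quotient.mk _
    congr 1
    ext
    change (∏ e ∈ Finset.Ico j l, u ^ p ^ e) * ((∏ e ∈ Finset.Ico i j, u ^ p ^ e) * (x : R)) =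
      (∏ e ∈ Finset.Ico i l, u ^ p ^ e) * (x : R)
    rw [← mul_assoc, mul_comm (∏ e ∈ Finset.Ico j l, u ^ p ^ e),
      Finset.prod_Ico_consecutive _ hij hjl]

theorem quotFrobMap_succ_mk (e : ℕ) (x : ↥(frobPow (p ^ e) Ω)) (y : ↥(frobPow (p ^ (e + 1)) Ω))
    (hxy : (y : R) = u ^ p ^ e * (x : R)) :
    quotFrobMap hΩ hI e (e + 1) (Nat.le_succ e) (Submodule.Quotient.mk x) =
      Submodule.Quotient.mk y := by
  rw [quotFrobMap, quotMul_mk]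
  congr 1
  ext
  simp [hxy]

end quotFrobMap

theorem frobPow_antitone {R : Type} [CommRing R] (p : ℕ) [ExpChar R p] (I : Ideal R) :
    Antitone fun e => frobPow (p ^ e) I := by
  refine antitone_nat_of_succ_le fun e => Ideal.span_le.2 ?_
  rintro _ ⟨x, hx, rfl⟩
  simp only [pow_succ p e, pow_mul]
  exact Ideal.pow_mem_of_mem _ (Ideal.subset_span (Set.mem_image_of_mem (· ^ p ^ e) hx)) _
    (expChar_pos R p)

theorem le_radical_frobPow {R : Type} [CommRing R] (q : ℕ) (I : Ideal R) :
    I ≤ (frobPow q I).radical :=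
  fun x hx => ⟨q, Ideal.subset_span ⟨x, hx, rfl⟩⟩

theorem frobPow_le_pow {R : Type} [CommRing R] (q : ℕ) (I : Ideal R) : frobPow q I ≤ I ^ q := by
  refine Ideal.span_le.2 ?_
  rintro _ ⟨x, hx, rfl⟩
  exact Ideal.pow_mem_pow hx q

namespace MatComplex

variable {R : Type} [CommRing R] {P : MatComplex R} {I Ω : Ideal R} {h : ℕ}

theorem IsChainMap.map {Q P : MatComplex R} {g} (hg : IsChainMap Q P g) (φ : R →+* R) :
    IsChainMap (Q.map φ) (P.map φ) (fun i => (g i).map φ) := fun i => by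
  have := congrArg (fun M => M.map φ) (hg i)
  simpa [Matrix.map_mul] using this

theorem aug_lift_map {Q : MatComplex R} {g : Matrix (Fin (P.rk 0)) (Fin (Q.rk 0)) R}
    (hg : ∀ x, P.aug ⬝ᵥ (g *ᵥ x) - Q.aug ⬝ᵥ x ∈ I) (φ : R →+* R) (x : Fin (Q.rk 0) → R) :
    (P.map φ).aug ⬝ᵥ (g.map φ *ᵥ x) - (Q.map φ).aug ⬝ᵥ x ∈ I.map φ := by
  rw [dotProduct_mulVec, ← sub_dotProduct, dotProduct_comm]
  refine dotProduct_mem _ _ fun j => ?_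
  have h1 := hg (Pi.single j 1)
  rw [Matrix.mulVec_single_one, dotProduct_single_one] at h1
  simpa [vecMul, dotProduct] using Ideal.mem_map_of_mem φ h1


variable (p : ℕ) [ExpChar R p]

theorem IsRes.frobPow [IsNoetherianRing R] (hP : P.IsRes I h) {e : ℕ}
    (hflat : EqFlat (iterateFrobenius R p e)) :
    (P.map (iterateFrobenius R p e)).IsRes (frobPow (p ^ e) I) h :=
  hP.map hflat

theorem IsPres.frobPow [IsNoetherianRing R] {c} (hc : P.IsPres I Ω h c) {e : ℕ}
    (hflat : EqFlat (iterateFrobenius R p e)) :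
    (P.map (iterateFrobenius R p e)).IsPres (frobPow (p ^ e) I) (frobPow (p ^ e) Ω) h
      (iterateFrobenius R p e ∘ c) :=
  hc.map hflat

/-- The identification of `Ext` with the subquotients of `R` cut out by Frobenius powers. -/
theorem exists_ext_equiv_quotFrob [IsNoetherianRing R] (hP : P.IsRes I h) {c}
    (hc : P.IsPres I Ω h c) {e : ℕ} (hflat : EqFlat (iterateFrobenius R p e)) :
    ∃ θ : extModule R h (R ⧸ frobPow (p ^ e) I) R ≃ₗ[R] quotFrob R p Ω I e,
      ∀ z, θ ((hP.frobPow p hflat).toExt z) = (hc.frobPow p hflat).toQuot z :=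
  LinearMap.exists_equiv_of_ker_eq _ _ (hP.frobPow p hflat).toExt_surjective
    (hc.frobPow p hflat).toQuot_surjective fun z => by
      rw [(hP.frobPow p hflat).toExt_eq_zero_iff, (hc.frobPow p hflat).toQuot_eq_zero_iff]

theorem toQuot_vecMul [IsNoetherianRing R] {c} (hc : P.IsPres I Ω h c) {e : ℕ}
    (hflat : EqFlat (iterateFrobenius R p e)) (hflat' : EqFlat (iterateFrobenius R p (e + 1)))
    {π : Matrix (Fin (P.rk h)) (Fin (P.rk h)) R} {a u : R}
    (hau : ∀ j, a * u * c j - (π *ᵥ (frobenius R p ∘ c)) j ∈ I.map (frobenius R p))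
    (hΩu : ∀ x ∈ frobPow (p ^ e) Ω, u ^ p ^ e * x ∈ frobPow (p ^ (e + 1)) Ω)
    (hIu : ∀ x ∈ frobPow (p ^ e) I, u ^ p ^ e * x ∈ frobPow (p ^ (e + 1)) I)
    (z : Fin (P.rk h) → R) :
    (hc.frobPow p hflat').toQuot (z ᵥ* π.map (iterateFrobenius R p e)) =
      a ^ p ^ e • quotMul (u ^ p ^ e) hΩu hIu ((hc.frobPow p hflat).toQuot z) := by
  have hmem : (a ^ p ^ e * (u ^ p ^ e * (z ⬝ᵥ (iterateFrobenius R p e ∘ c)))) -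
      (z ᵥ* π.map (iterateFrobenius R p e)) ⬝ᵥ (iterateFrobenius R p (e + 1) ∘ c) ∈
      frobPow (p ^ (e + 1)) I := by
    rw [frobPow_pow_succ]
    have h1 : a ^ p ^ e * (u ^ p ^ e * (z ⬝ᵥ (iterateFrobenius R p e ∘ c))) -
        (z ᵥ* π.map (iterateFrobenius R p e)) ⬝ᵥ (iterateFrobenius R p (e + 1) ∘ c) =
        z ⬝ᵥ fun j => iterateFrobenius R p e (a * u * c j - (π *ᵥ (frobenius R p ∘ c)) j) := by
      have h2 : iterateFrobenius R p (e + 1) ∘ c =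
          iterateFrobenius R p e ∘ frobenius R p ∘ c := by
        ext j
        simp [iterateFrobenius_def, frobenius_def, ← pow_mul, pow_succ']
      have h3 : (fun j => iterateFrobenius R p e (a * u * c j - (π *ᵥ (frobenius R p ∘ c)) j)) =
          (a ^ p ^ e * u ^ p ^ e) • (iterateFrobenius R p e ∘ c) -
            π.map (iterateFrobenius R p e) *ᵥ (iterateFrobenius R p e ∘ frobenius R p ∘ c) := by
        ext j
        rw [map_sub, RingHom.map_mulVec]
        simp [iterateFrobenius_def, mul_pow]
      rw [h3, h2, dotProduct_sub, dotProduct_smul, dotProduct_mulVec, smul_eq_mul, mul_assoc]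
    rw [h1]
    exact dotProduct_mem _ _ fun j => Ideal.mem_map_of_mem _ (hau j)
  refine ((Submodule.Quotient.eq (Submodule.comap (frobPow (p ^ (e + 1)) Ω).subtype
    (frobPow (p ^ (e + 1)) I : Submodule R R))).2 ?_).symm
  exact hmem

theorem extTransition_toExt [IsNoetherianRing R] (hP : P.IsRes I h) {e : ℕ}
    (hflat : EqFlat (iterateFrobenius R p e)) (hflat' : EqFlat (iterateFrobenius R p (e + 1)))
    {π} (hπ : IsChainMap (P.map (frobenius R p)) P π)
    (hπ0 : ∀ x, P.aug ⬝ᵥ (π 0 *ᵥ x) - (P.map (frobenius R p)).aug ⬝ᵥ x ∈ I)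
    (z : Fin (P.rk h) → R) :
    (localCohomology.extTransition _ (frobPow_antitone p I) h (ModuleCat.of R R) e).hom
        ((hP.frobPow p hflat).toExt z) =
      (hP.frobPow p hflat').toExt (z ᵥ* (π h).map (iterateFrobenius R p e)) := by
  have hd (i : ℕ) : (((P.d i).map (frobenius R p)).map (iterateFrobenius R p e)) =
      (P.d i).map (iterateFrobenius R p (e + 1)) := by
    ext
    simp [iterateFrobenius_def, frobenius_def, ← pow_mul, pow_succ']
  have haug : (fun i => iterateFrobenius R p e (frobenius R p (P.aug i))) =
      fun i => iterateFrobenius R p (e + 1) (P.aug i) := by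
    ext
    simp [iterateFrobenius_def, frobenius_def, ← pow_mul, pow_succ']
  refine (hP.frobPow p hflat).toExt_naturality (hP.frobPow p hflat') (frobPow_antitone p I e.le_succ)
    (g := fun i => (π i).map (iterateFrobenius R p e)) ?_ ?_ z
  · intro i
    have := hπ.map (iterateFrobenius R p e) i
    change _ * ((P.d i).map (frobenius R p)).map (iterateFrobenius R p e) = _ at this
    rwa [hd] at this
  · intro x
    have := aug_lift_map hπ0 (iterateFrobenius R p e) x
    change _ - (fun i => iterateFrobenius R p e (frobenius R p (P.aug i))) ⬝ᵥ x ∈ _ at this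
    rwa [haug] at this

theorem nonempty_localCohomology_equiv [IsNoetherianRing R] (hP : P.IsRes I h) {c}
    (hc : P.IsPres I Ω h c) (hp : 1 < p) (hflat : ∀ e, EqFlat (iterateFrobenius R p e))
    {π} (hπ : IsChainMap (P.map (frobenius R p)) P π)
    (hπ0 : ∀ x, P.aug ⬝ᵥ (π 0 *ᵥ x) - (P.map (frobenius R p)).aug ⬝ᵥ x ∈ I)
    {a u : R} (ha : IsUnit a)
    (hau : ∀ j, a * u * c j - (π h *ᵥ (frobenius R p ∘ c)) j ∈ I.map (frobenius R p))
    (hΩu : ∀ e : ℕ, ∀ x ∈ frobPow (p ^ e) Ω, u ^ p ^ e * x ∈ frobPow (p ^ (e + 1)) Ω)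
    (hIu : ∀ e : ℕ, ∀ x ∈ frobPow (p ^ e) I, u ^ p ^ e * x ∈ frobPow (p ^ (e + 1)) I) :
    Nonempty (((localCohomology I h).obj (ModuleCat.of R R)) ≃ₗ[R]
      Module.DirectLimit (quotFrob R p Ω I) (fun i j h => quotFrobMap hΩu hIu i j h)) := by
  have := directedSystem_quotFrobMap hΩu hIu
  obtain ⟨a, rfl⟩ := ha
  choose θ hθ using fun e => exists_ext_equiv_quotFrob p hP hc (hflat e)
  let b : ℕ → Rˣ := fun e => ∏ k ∈ Finset.range e, (a ^ p ^ k)⁻¹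
  have hb : ∀ e, b (e + 1) * a ^ p ^ e = b e := fun e => by
    simp [b, Finset.prod_range_succ]
  refine localCohomology.nonempty_directLimit_equiv _ (frobPow_antitone p I)
    (fun e => le_radical_frobPow _ I) (fun t => ⟨t, ?_⟩) h _ _ _
    (fun e => (θ e).trans (LinearEquiv.smulOfUnit (b e))) fun e x => ?_
  · exact (frobPow_le_pow _ I).trans (Ideal.pow_le_pow_right (Nat.lt_pow_self hp).le)
  · obtain ⟨z, rfl⟩ := (hP.frobPow p (hflat e)).toExt_surjective x
    have h1 := extTransition_toExt p hP (hflat e) (hflat (e + 1)) hπ hπ0 z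
    have h2 := toQuot_vecMul p hc (hflat e) (hflat (e + 1)) hau (hΩu e) (hIu e) z
    have h3 : quotFrobMap hΩu hIu e (e + 1) e.le_succ ((hc.frobPow p (hflat e)).toQuot z) =
        quotMul (u ^ p ^ e) (hΩu e) (hIu e) ((hc.frobPow p (hflat e)).toQuot z) :=
      quotFrobMap_succ_mk _ _ _ _ _ rfl
    change b (e + 1) • θ (e + 1) _ = quotFrobMap hΩu hIu e (e + 1) e.le_succ (b e • θ e _)
    rw [h1, hθ, hθ, h2, Units.smul_def, Units.smul_def, map_smul, h3, smul_smul, ← hb e, Units.val_mul,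
      Units.val_pow_eq_pow_val]

end MatComplex

end

/-- If the class of `u` generates `((I^{[p]} : I) ∩ (Ω^{[p]} : Ω))/I^{[p]}`, then
multiplication by `u^{p^e}` maps `Ω^{[p^e]}` into `Ω^{[p^{e+1}]}` and `I^{[p^e]}` into
`I^{[p^{e+1}]}`, and `H^h_I(R)` (with `h = n - d` the height of `I`) is the colimit of the
direct system `Ω/I → Ω^{[p]}/I^{[p]} → Ω^{[p²]}/I^{[p²]} → ⋯` whose transition maps are
induced by multiplication by `u^{p^e}`. -/
theorem stmt3 (p : ℕ) (hp : p.Prime) (k : Type) [Field k] [CharP k p]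
    (n d : ℕ) (hd : 1 ≤ d)
    (I : Ideal (MvPowerSeries (Fin n) k))
    (hred : IsReduced (MvPowerSeries (Fin n) k ⧸ I))
    (hCM : IsCohenMacaulayLocalOfDim (MvPowerSeries (Fin n) k ⧸ I)
      ((IsLocalRing.maximalIdeal (MvPowerSeries (Fin n) k)).map (Ideal.Quotient.mk I)) d)
    (Ω : Ideal (MvPowerSeries (Fin n) k))
    (hΩ : IsCanonicalIdeal (MvPowerSeries (Fin n) k) (n - d) I Ω)
    (u : MvPowerSeries (Fin n) k)
    (hu : Submodule.colon (frobPow p I) I ⊓ Submodule.colon (frobPow p Ω) Ω =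
      frobPow p I ⊔ Ideal.span {u}) :
    (∀ e : ℕ, ∀ x ∈ frobPow (p ^ e) Ω, u ^ p ^ e * x ∈ frobPow (p ^ (e + 1)) Ω) ∧
    (∀ e : ℕ, ∀ x ∈ frobPow (p ^ e) I, u ^ p ^ e * x ∈ frobPow (p ^ (e + 1)) I) ∧
    ∃ f : ∀ i j : ℕ, i ≤ j →
        quotFrob (MvPowerSeries (Fin n) k) p Ω I i →ₗ[MvPowerSeries (Fin n) k]
          quotFrob (MvPowerSeries (Fin n) k) p Ω I j,
      DirectedSystem (quotFrob (MvPowerSeries (Fin n) k) p Ω I) (fun i j h => f i j h) ∧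
      (∀ (e : ℕ) (x : ↥(frobPow (p ^ e) Ω)) (y : ↥(frobPow (p ^ (e + 1)) Ω)),
        (y : MvPowerSeries (Fin n) k) = u ^ p ^ e * (x : MvPowerSeries (Fin n) k) →
        f e (e + 1) (Nat.le_succ e) (Submodule.Quotient.mk x) = Submodule.Quotient.mk y) ∧
      Nonempty
        (((localCohomology I (n - d)).obj (ModuleCat.of _ (MvPowerSeries (Fin n) k)))
          ≃ₗ[MvPowerSeries (Fin n) k]
          Module.DirectLimit (quotFrob (MvPowerSeries (Fin n) k) p Ω I)
            (fun i j h => f i j h)) := by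
  have := Fact.mk hp
  have : CharP (MvPowerSeries (Fin n) k) p :=
    charP_of_injective_algebraMap (algebraMap k (MvPowerSeries (Fin n) k)).injective p
  have hflat (e : ℕ) : MatComplex.EqFlat (iterateFrobenius (MvPowerSeries (Fin n) k) p e) :=
    fun a b _ M s hs => MvPowerSeries.mem_span_pow_of_mulVec p e M s hs
  have hflat1 : MatComplex.EqFlat (frobenius (MvPowerSeries (Fin n) k) p) := by
    rw [← iterateFrobenius_one]
    exact hflat 1
  have hmem : u ∈ Submodule.colon (frobPow p I) (I : Set _) ⊓
      Submodule.colon (frobPow p Ω) (Ω : Set _) := by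
    rw [hu]
    exact Submodule.mem_sup_right (Ideal.mem_span_singleton_self u)
  have hΩu := pow_mul_mem_frobPow p hmem.2
  have hIu := pow_mul_mem_frobPow p hmem.1
  refine ⟨hΩu, hIu, quotFrobMap hΩu hIu, directedSystem_quotFrobMap hΩu hIu,
    quotFrobMap_succ_mk hΩu hIu, ?_⟩
  have hI : I ≠ ⊤ := by
    rintro rfl
    have := hCM.1
    rw [ringKrullDim_eq_bot_of_subsingleton] at this
    exact absurd this.symm (by simp)
  obtain ⟨hpd, hext⟩ := MvPowerSeries.projectiveDimension_and_ext_of_isCohenMacaulay hCM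
  obtain ⟨P, hP⟩ := MatComplex.exists_isRes hI hpd hext
  obtain ⟨c, hc⟩ := MatComplex.exists_isPres hP hΩ
  obtain ⟨y, hy⟩ := MatComplex.IsPres.exists_regular hP hc
  obtain ⟨π, hπ, hπ0⟩ := MatComplex.exists_chainMap hP (hP.map hflat1)
    (Ideal.map_le_iff_le_comap.2 fun x hx => I.pow_mem_of_mem hx p hp.pos)
  obtain ⟨a, ha, hau⟩ := MatComplex.exists_unit_smul_sub_mem hflat1
    (fun x => dvd_pow_self x hp.ne_zero) hP hc y hy hπ hπ0 u hu
  exact MatComplex.nonempty_localCohomology_equiv p hP hc hp.one_lt hflat hπ hπ0 ha hau hΩu hIu
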